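/- arXiv:2207.01957 — 2 statements merged into one kernel-verified Lean document; each statement's English description precedes it below -/
import Mathlib

section
/- On a unital liminal C*-algebra A, every state is maximally mixed. -/
universe u

open scoped ComplexConjugate ComplexOrder

noncomputable section

variable {A : Type u} [NormedRing A] [StarRing A] [CStarRing A]
  [NormedAlgebra ℂ A] [StarModule ℂ A] [CompleteSpace A]

/-- A linear functional on a C*-algebra is positive if it is nonnegative
on all elements of the form `a* a`. -/
def IsPositiveFunctional (ω : A →L[ℂ] ℂ) : Prop :=
  ∀ a : A, 0 ≤ ω (star a * a)

/-- A state is a positive unital linear functional. -/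
def IsState (ω : A →L[ℂ] ℂ) : Prop :=
  IsPositiveFunctional ω ∧ ω 1 = 1

/-- A hermitian (self-adjoint) linear functional. -/
def IsHermitianFunctional (ω : A →L[ℂ] ℂ) : Prop :=
  ∀ a : A, ω (star a) = conj (ω a)

/-- `ωp`, `ωm` form the Jordan decomposition of the hermitian functional `ω`. -/
def IsJordanDecomposition (ω ωp ωm : A →L[ℂ] ℂ) : Prop :=
  IsPositiveFunctional ωp ∧ IsPositiveFunctional ωm ∧ ω = ωp - ωm ∧ ‖ω‖ = ‖ωp‖ + ‖ωm‖

/-- An element of a C*-algebra is positive iff it is of the form `b* b`. -/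
def IsPositiveElem (c : A) : Prop :=
  ∃ b : A, c = star b * b

/-- `E(A)`: the unital completely positive elementary maps
`x ↦ ∑ i, (a i)* x (a i)` with `∑ i, (a i)* (a i) = 1`. -/
def IsElementaryUCP (φ : A →L[ℂ] A) : Prop :=
  ∃ (n : ℕ) (a : Fin n → A), (∑ i, star (a i) * a i) = 1 ∧
    ∀ x : A, φ x = ∑ i, star (a i) * x * a i

/-- The set `ω ∘ E(A) = {ω ∘ φ : φ ∈ E(A)}`. -/
def mixSet (ω : A →L[ℂ] ℂ) : Set (A →L[ℂ] ℂ) :=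
  {ρ | ∃ φ : A →L[ℂ] A, IsElementaryUCP φ ∧ ρ = ω.comp φ}

/-- Membership in the weak* closure of a set of functionals: every basic weak*
neighbourhood of `ρ` (given by finitely many points and `ε > 0`) meets `S`. -/
def InWeakStarClosure (S : Set (A →L[ℂ] ℂ)) (ρ : A →L[ℂ] ℂ) : Prop :=
  ∀ ε : ℝ, 0 < ε → ∀ (n : ℕ) (x : Fin n → A), ∃ σ ∈ S, ∀ i, ‖ρ (x i) - σ (x i)‖ < ε

/-- Norm-closed two-sided ideals (which in a C*-algebra are automatically
`*`-closed `ℂ`-submodules). -/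
def IsClosedIdeal (J : Set A) : Prop :=
  IsClosed J ∧ (0 : A) ∈ J ∧ (∀ x ∈ J, ∀ y ∈ J, x + y ∈ J) ∧
    (∀ (c : ℂ), ∀ x ∈ J, c • x ∈ J) ∧ (∀ (a : A), ∀ x ∈ J, a * x ∈ J ∧ x * a ∈ J)

/-- The norm `‖ω|J‖` of the restriction of a functional `ω` to a subset `J`. -/
def normRestrict (ω : A →L[ℂ] ℂ) (J : Set A) : ℝ :=
  sSup {r : ℝ | ∃ x ∈ J, ‖x‖ ≤ 1 ∧ r = ‖ω x‖}

/-- The norm `‖cω‖` of the functional `x ↦ ω (c * x)`. -/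
def mulNorm (ω : A →L[ℂ] ℂ) (c : A) : ℝ :=
  sSup {r : ℝ | ∃ x : A, ‖x‖ ≤ 1 ∧ r = ‖ω (c * x)‖}

/-- A state `ω` is maximally mixed if every state `ρ` that is more mixed than `ω`
(i.e. `ρ` lies in the weak* closure of `ω ∘ E(A)`) satisfies in turn that `ω` is
more mixed than `ρ`. -/
def IsMaximallyMixed (ω : A →L[ℂ] ℂ) : Prop :=
  IsState ω ∧ ∀ ρ : A →L[ℂ] ℂ, IsState ρ →
    InWeakStarClosure (mixSet ω) ρ → InWeakStarClosure (mixSet ρ) ω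

/-- Maximal (norm-closed two-sided) ideals. -/
def IsMaximalIdeal (N : Set A) : Prop :=
  IsClosedIdeal N ∧ N ≠ Set.univ ∧
    ∀ N' : Set A, IsClosedIdeal N' → N' ≠ Set.univ → N ⊆ N' → N' = N

/-- The strong radical: the intersection of all maximal ideals. -/
def strongRadical (A : Type u) [NormedRing A] [StarRing A] [CStarRing A]
    [NormedAlgebra ℂ A] [StarModule ℂ A] [CompleteSpace A] : Set A :=
  ⋂₀ {N : Set A | IsMaximalIdeal N}

/-- A witness that `P` is the kernel of an irreducible representation of `A`
on some Hilbert space. -/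
structure IrreducibleRepWitness (A : Type u) [NormedRing A] [StarRing A] [CStarRing A]
    [NormedAlgebra ℂ A] [StarModule ℂ A] [CompleteSpace A] (P : Set A) :
    Type (u + 1) where
  /-- the Hilbert space of the representation -/
  space : Type u
  [nacg : NormedAddCommGroup space]
  [ips : InnerProductSpace ℂ space]
  [cplt : CompleteSpace space]
  [nontriv : Nontrivial space]
  /-- the representation -/
  π : A →L[ℂ] (space →L[ℂ] space)
  map_mul' : ∀ x y : A, π (x * y) = π x * π y
  map_star' : ∀ x : A, π (star x) = star (π x)
  map_one' : π 1 = 1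
  /-- topological irreducibility: every nonzero vector is cyclic -/
  irreducible' : ∀ ξ : space, ξ ≠ 0 → Dense {η : space | ∃ a : A, η = π a ξ}
  ker_eq' : P = {a : A | π a = 0}

/-- `P` is a primitive ideal: the kernel of some irreducible representation. -/
def IsPrimitiveIdeal (P : Set A) : Prop :=
  Nonempty (IrreducibleRepWitness A P)

/-- The primitive spectrum of `A` is Hausdorff: any two distinct points of the
primitive spectrum can be separated by disjoint basic open sets of the
hull-kernel topology. -/
def HasHausdorffPrimitiveSpectrum
    (A : Type u) [NormedRing A] [StarRing A] [CStarRing A]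
    [NormedAlgebra ℂ A] [StarModule ℂ A] [CompleteSpace A] : Prop :=
  ∀ P Q : Set A, IsPrimitiveIdeal P → IsPrimitiveIdeal Q → P ≠ Q →
    ∃ I J : Set A, IsClosedIdeal I ∧ IsClosedIdeal J ∧ ¬I ⊆ P ∧ ¬J ⊆ Q ∧
      ∀ S : Set A, IsPrimitiveIdeal S → I ⊆ S ∨ J ⊆ S


namespace MaxMix

open Filter Topology

section basics

variable {B : Type u} [CStarAlgebra B] [PartialOrder B] [StarOrderedRing B]

/-- Turn a positive functional into Mathlib's bundled positive map. -/
def toPLM (f : B →L[ℂ] ℂ) (hf : IsPositiveFunctional f) : B →ₚ[ℂ] ℂ :=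
  PositiveLinearMap.mk₀ (f : B →ₗ[ℂ] ℂ) (fun x hx => by
    obtain ⟨y, rfl⟩ := CStarAlgebra.nonneg_iff_eq_star_mul_self.mp hx
    exact hf y)

@[simp] lemma toPLM_apply (f : B →L[ℂ] ℂ) (hf : IsPositiveFunctional f) (x : B) :
    toPLM f hf x = f x := rfl

/-- The `L²` seminorm attached to a positive functional. -/
def nrm (t : B →ₚ[ℂ] ℂ) (x : B) : ℝ := ‖t.toPreGNS x‖

variable (t : B →ₚ[ℂ] ℂ)

lemma nrm_nonneg (x : B) : 0 ≤ nrm t x := norm_nonneg _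

lemma nrm_sq (x : B) : nrm t x ^ 2 = (t (star x * x)).re := by
  have h := t.preGNS_norm_sq (t.toPreGNS x)
  have := congrArg Complex.re h
  rw [← Complex.ofReal_pow, Complex.ofReal_re] at this
  exact this

lemma nrm_add (x y : B) : nrm t (x + y) ≤ nrm t x + nrm t y := by
  unfold nrm; rw [map_add]; exact norm_add_le _ _

lemma nrm_sub (x y : B) : nrm t (x - y) ≤ nrm t x + nrm t y := by
  unfold nrm; rw [map_sub]; exact norm_sub_le _ _

lemma nrm_smul (c : ℂ) (x : B) : nrm t (c • x) = ‖c‖ * nrm t x := by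
  unfold nrm; rw [map_smul]; exact norm_smul _ _

lemma nrm_neg (x : B) : nrm t (-x) = nrm t x := by
  unfold nrm; rw [map_neg]; exact norm_neg _

lemma nrm_sub_comm (x y : B) : nrm t (x - y) = nrm t (y - x) := by
  rw [← nrm_neg, neg_sub]

lemma nrm_zero : nrm t 0 = 0 := by
  unfold nrm; rw [map_zero]; exact norm_zero

lemma nrm_sum {ι : Type*} (s : Finset ι) (f : ι → B) :
    nrm t (∑ i ∈ s, f i) ≤ ∑ i ∈ s, nrm t (f i) := by
  unfold nrm; rw [map_sum]; exact norm_sum_le _ _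

lemma cs (x y : B) : ‖t (star x * y)‖ ≤ nrm t x * nrm t y :=
  norm_inner_le_norm (𝕜 := ℂ) (t.toPreGNS x) (t.toPreGNS y)

lemma nrm_mul_left (a x : B) : nrm t (a * x) ≤ ‖a‖ * nrm t x := by
  have h := (t.leftMulMapPreGNS a).le_opNorm (t.toPreGNS x)
  refine h.trans ?_
  exact mul_le_mul_of_nonneg_right (LinearMap.mkContinuous_norm_le _ (norm_nonneg _) _)
    (norm_nonneg _)

lemma parallelogram (x y : B) :
    nrm t (x + y) ^ 2 + nrm t (x - y) ^ 2 = 2 * (nrm t x ^ 2 + nrm t y ^ 2) := by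
  have := parallelogram_law_with_norm ℂ (t.toPreGNS x) (t.toPreGNS y)
  unfold nrm; rw [map_add, map_sub]; nlinarith

lemma plm_real {x : B} (hx : IsSelfAdjoint x) : ((t x).re : ℂ) = t x := by
  have : star (t x) = t x := by rw [← map_star, hx.star_eq]
  exact Complex.conj_eq_iff_re.mp this

lemma plm_nonneg {x : B} (hx : 0 ≤ x) : 0 ≤ (t x).re :=
  (Complex.nonneg_iff.mp (t.map_nonneg hx)).1

lemma conj_bound (w x : B) : ‖t (star w * x * w)‖ ≤ ‖x‖ * (t (star w * w)).re := by
  have := cs t w (x * w)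
  rw [← nrm_sq, mul_assoc]
  have h2 := nrm_mul_left t x w
  nlinarith [nrm_nonneg t w]

lemma nrm_one_sq : nrm t 1 ^ 2 = (t 1).re := by rw [nrm_sq]; simp

lemma nrm_le (x : B) : nrm t x ≤ ‖x‖ * nrm t 1 := by
  simpa using nrm_mul_left t x 1

lemma plm_bound (x : B) : ‖t x‖ ≤ ‖x‖ * (t 1).re := by
  simpa using conj_bound t 1 x

section trace

lemma nrm_star (ht : ∀ x y, t (x * y) = t (y * x)) (x : B) : nrm t (star x) = nrm t x := by
  have : nrm t (star x) ^ 2 = nrm t x ^ 2 := by rw [nrm_sq, nrm_sq, star_star, ht]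
  exact (sq_eq_sq₀ (nrm_nonneg _ _) (nrm_nonneg _ _)).mp this

lemma nrm_mul_right (ht : ∀ x y, t (x * y) = t (y * x)) (x a : B) : nrm t (x * a) ≤ ‖a‖ * nrm t x := by
  rw [← nrm_star t ht, star_mul, ← nrm_star t ht x, ← norm_star a]
  exact nrm_mul_left _ _ _

lemma nrm_unitary_right (ht : ∀ x y, t (x * y) = t (y * x)) {u : B} (hu : u ∈ unitary B) (x : B) : nrm t (x * u) = nrm t x := by
  have : nrm t (x * u) ^ 2 = nrm t x ^ 2 := by
    rw [nrm_sq, nrm_sq, ht, star_mul]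
    rw [show x * u * (star u * star x) = x * (u * star u) * star x by noncomm_ring]
    rw [Unitary.mul_star_self_of_mem hu, mul_one, ht]
  exact (sq_eq_sq₀ (nrm_nonneg _ _) (nrm_nonneg _ _)).mp this

lemma nrm_unitary_left {u : B} (hu : u ∈ unitary B) (x : B) : nrm t (u * x) = nrm t x := by
  have : nrm t (u * x) ^ 2 = nrm t x ^ 2 := by
    rw [nrm_sq, nrm_sq, star_mul]
    rw [show star x * star u * (u * x) = star x * (star u * u) * x by noncomm_ring]
    rw [Unitary.star_mul_self_of_mem hu, mul_one]
  exact (sq_eq_sq₀ (nrm_nonneg _ _) (nrm_nonneg _ _)).mp this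

lemma trace_real (ht : ∀ x y, t (x * y) = t (y * x)) {a x : B} (ha : IsSelfAdjoint a) (hx : IsSelfAdjoint x) :
    ((t (a * x)).re : ℂ) = t (a * x) := by
  have : star (t (a * x)) = t (a * x) := by
    rw [← map_star, star_mul, ha.star_eq, hx.star_eq, ht]
  exact Complex.conj_eq_iff_re.mp this

end trace

/-- a positive functional dominated by `t` is bounded for the `L²` seminorm -/
lemma dom_bound (f : B →L[ℂ] ℂ) (hf : IsPositiveFunctional f) {N : ℝ} (hN0 : 0 ≤ N)
    (hN : ∀ x, (f (star x * x)).re ≤ N * (t (star x * x)).re) (x : B) :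
    ‖f x‖ ≤ √((f 1).re * N) * nrm t x := by
  have h := cs (toPLM f hf) 1 x
  simp only [star_one, one_mul, toPLM_apply] at h
  refine h.trans ?_
  have h1 := nrm_one_sq (toPLM f hf)
  have h2 := nrm_sq (toPLM f hf) x
  have h3 := nrm_sq t x
  have h4 := hN x
  simp only [toPLM_apply] at h1 h2
  have h5 : nrm (toPLM f hf) x ≤ √N * nrm t x := by
    refine (sq_le_sq₀ (nrm_nonneg _ _) (mul_nonneg (Real.sqrt_nonneg _) (nrm_nonneg t x))).mp ?_
    rw [mul_pow, Real.sq_sqrt hN0, h2, h3]; exact h4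
  have h6 : nrm (toPLM f hf) 1 = √((f 1).re) := by
    rw [← h1, Real.sqrt_sq (nrm_nonneg _ _)]
  rw [h6, Real.sqrt_mul (by rw [← h1]; positivity), mul_assoc]
  gcongr

end basics

end MaxMix

namespace MaxMix

open Filter Topology

section riesz

variable {B : Type u} [CStarAlgebra B] [PartialOrder B] [StarOrderedRing B]
variable (t : B →ₚ[ℂ] ℂ)

lemma nrm_add_sq_real (ht : ∀ x y, t (x * y) = t (y * x)) {b x : B} (hb : IsSelfAdjoint b)
    (hx : IsSelfAdjoint x) (s : ℝ) :
    nrm t (b + (s : ℂ) • x) ^ 2 = nrm t b ^ 2 + 2 * s * (t (b * x)).re + s ^ 2 * nrm t x ^ 2 := by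
  rw [nrm_sq, nrm_sq, nrm_sq]
  simp only [star_add, star_smul, hb.star_eq, hx.star_eq, add_mul, mul_add, smul_mul_assoc,
    mul_smul_comm, map_add, map_smul, ht x b]
  simp
  ring

/-- approximate Riesz representation on self-adjoint elements -/
lemma riesz_sa (ht : ∀ x y, t (x * y) = t (y * x)) (f : B →L[ℂ] ℂ) {C : ℝ} (hC0 : 0 ≤ C)
    (hC : ∀ x, ‖f x‖ ≤ C * nrm t x) {δ : ℝ} (hδ : 0 < δ) :
    ∃ b : B, IsSelfAdjoint b ∧ ∀ x, IsSelfAdjoint x →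
      |(f x).re - (t (b * x)).re| ≤ δ * nrm t x := by
  let Q : B → ℝ := fun b => nrm t b ^ 2 - 2 * (f b).re
  let S : Set ℝ := Q '' {b | IsSelfAdjoint b}
  have hne : S.Nonempty := ⟨Q 0, 0, IsSelfAdjoint.zero B, rfl⟩
  have hbdd : BddBelow S := by
    refine ⟨-C ^ 2, ?_⟩
    rintro _ ⟨b, -, rfl⟩
    have h1 := (Complex.re_le_norm (f b)).trans (hC b)
    simp only [Q]
    nlinarith [sq_nonneg (nrm t b - C)]
  obtain ⟨_, ⟨b, hb, rfl⟩, hlt⟩ := exists_lt_of_csInf_lt hne (lt_add_of_pos_right (sInf S)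
    (show 0 < δ ^ 2 by positivity))
  refine ⟨b, hb, fun x hx => ?_⟩
  have key : ∀ s : ℝ, 0 ≤ nrm t x ^ 2 * (s * s) + (2 * ((t (b * x)).re - (f x).re)) * s + δ ^ 2 := by
    intro s
    have hmem : Q (b + (s : ℂ) • x) ∈ S := by
      refine ⟨_, ?_, rfl⟩
      have : IsSelfAdjoint ((s : ℂ) • x) := by
        simp [IsSelfAdjoint, star_smul, hx.star_eq]
      exact IsSelfAdjoint.add hb this
    have h1 := csInf_le hbdd hmem
    have h2 := nrm_add_sq_real t ht hb hx s
    simp only [Q] at h1 hlt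
    rw [h2, map_add, map_smul] at h1
    simp at h1
    nlinarith
  have hd := discrim_le_zero key
  rw [discrim] at hd
  apply abs_le_of_sq_le_sq _ (mul_nonneg hδ.le (nrm_nonneg _ _))
  nlinarith

lemma riesz_pos (ht : ∀ x y, t (x * y) = t (y * x)) (f : B →L[ℂ] ℂ)
    (hf : IsPositiveFunctional f) {C : ℝ} (hC0 : 0 ≤ C)
    (hC : ∀ x, ‖f x‖ ≤ C * nrm t x) {δ : ℝ} (hδ : 0 < δ) :
    ∃ a : B, 0 ≤ a ∧ ∀ x, ‖f x - t (a * x)‖ ≤ δ * nrm t x := by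
  obtain ⟨b, hb, h⟩ := riesz_sa t ht f hC0 hC (show 0 < δ / 4 by positivity)
  have hdec : b⁺ - b⁻ = b := CFC.posPart_sub_negPart b hb
  have hmul : b⁺ * b⁻ = 0 := CFC.posPart_mul_negPart b
  have hp : 0 ≤ b⁺ := CFC.posPart_nonneg b
  have hn : 0 ≤ b⁻ := CFC.negPart_nonneg b
  have hnsa : IsSelfAdjoint b⁻ := .of_nonneg hn
  have hneg : nrm t b⁻ ≤ δ / 4 := by
    have h1 := (abs_le.mp (h b⁻ hnsa)).2
    have h2 : b * b⁻ = - (star b⁻ * b⁻) := by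
      rw [hnsa.star_eq]; nth_rw 1 [← hdec]; rw [sub_mul, hmul, zero_sub]
    rw [h2, map_neg, Complex.neg_re, ← nrm_sq] at h1
    have h3 : 0 ≤ (f b⁻).re := plm_nonneg (toPLM f hf) hn
    by_contra hlt
    push Not at hlt
    nlinarith [nrm_nonneg t b⁻]
  have hsa : ∀ x, IsSelfAdjoint x → ‖f x - t (b⁺ * x)‖ ≤ δ / 2 * nrm t x := by
    intro x hx
    have e1 : ((f x).re : ℂ) = f x := plm_real (toPLM f hf) hx
    have e2 := trace_real t ht (IsSelfAdjoint.of_nonneg hp) hx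
    rw [← e1, ← e2, ← Complex.ofReal_sub, Complex.norm_real, Real.norm_eq_abs]
    have h1 := h x hx
    have h2 : (t (b⁺ * x)).re = (t (b * x)).re + (t (star b⁻ * x)).re := by
      rw [hnsa.star_eq, ← Complex.add_re, ← map_add, ← add_mul]
      congr 3
      nth_rw 2 [← hdec]; abel
    have h3 := (Complex.abs_re_le_norm _).trans (cs t b⁻ x)
    have h4 : nrm t b⁻ * nrm t x ≤ δ / 4 * nrm t x :=
      mul_le_mul_of_nonneg_right hneg (nrm_nonneg _ _)
    rw [h2]
    rw [abs_le] at *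
    constructor <;> linarith
  refine ⟨b⁺, hp, fun x => ?_⟩
  have hx := realPart_add_I_smul_imaginaryPart x
  have hr := hsa (realPart x : B) (realPart x).2
  have hi := hsa (imaginaryPart x : B) (imaginaryPart x).2
  have hstar : nrm t (star x) = nrm t x := nrm_star t ht x
  have nr : nrm t (realPart x : B) ≤ nrm t x := by
    have : (realPart x : B) = (2⁻¹ : ℂ) • (x + star x) := by
      rw [realPart_apply_coe]
      rw [← Complex.coe_smul]; simp
    rw [this, nrm_smul]
    have := nrm_add t x (star x)
    simp; linarith
  have ni : nrm t (imaginaryPart x : B) ≤ nrm t x := by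
    have : (imaginaryPart x : B) = -Complex.I • (2⁻¹ : ℂ) • (x - star x) := by
      rw [imaginaryPart_apply_coe]
      rw [← Complex.coe_smul]; simp
    rw [this, nrm_smul, nrm_smul]
    have := nrm_sub t x (star x)
    simp; linarith
  have e : f x - t (b⁺ * x) = (f (realPart x : B) - t (b⁺ * (realPart x : B))) +
      Complex.I * (f (imaginaryPart x : B) - t (b⁺ * (imaginaryPart x : B))) := by
    conv_lhs => rw [← hx]
    simp only [map_add, map_smul, mul_add, mul_smul_comm, smul_eq_mul]
    ring
  rw [e]
  refine (norm_add_le _ _).trans ?_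
  rw [norm_mul, Complex.norm_I, one_mul]
  nlinarith

/-- the unitary orbit convex hull -/
def orb (a : B) : Set B := convexHull ℝ {y | ∃ u ∈ unitary B, y = star u * a * u}

lemma self_mem_orb (a : B) : a ∈ orb a :=
  subset_convexHull _ _ ⟨1, one_mem _, by simp⟩

/-- conjugation as a real linear map -/
def conjMap (v : B) : B →ₗ[ℝ] B :=
  LinearMap.mulLeft ℝ (star v) ∘ₗ LinearMap.mulRight ℝ v

lemma conjMap_apply (v x : B) : conjMap v x = star v * x * v := by
  simp [conjMap, mul_assoc]

lemma orb_conj {a s v : B} (hs : s ∈ orb a) (hv : v ∈ unitary B) : star v * s * v ∈ orb a := by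
  have : orb a ⊆ (conjMap v) ⁻¹' (orb a) := by
    refine convexHull_min ?_ ((convex_convexHull ℝ _).linear_preimage _)
    rintro _ ⟨u, hu, rfl⟩
    refine subset_convexHull _ _ ⟨u * v, mul_mem hu hv, ?_⟩
    rw [conjMap_apply, star_mul]; noncomm_ring
  have := this hs
  rwa [Set.mem_preimage, conjMap_apply] at this

lemma orb_sa {a s : B} (ha : IsSelfAdjoint a) (hs : s ∈ orb a) : IsSelfAdjoint s := by
  have : orb a ⊆ ((selfAdjoint.submodule ℝ B : Submodule ℝ B) : Set B) := by
    refine convexHull_min ?_ (Submodule.convex _)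
    rintro _ ⟨u, hu, rfl⟩
    change IsSelfAdjoint _
    exact ha.conjugate' u
  exact this hs

lemma orb_trace {a s m : B} (ht : ∀ x y, t (x * y) = t (y * x)) (hs : s ∈ orb a) {r : ℝ}
    (hm : ∀ u ∈ unitary B, nrm t (m * u - u * m) ≤ r) :
    (t (m * s)).re - (t (m * a)).re ≤ r * nrm t a := by
  have hconv : Convex ℝ {s : B | (t (m * s)).re ≤ (t (m * a)).re + r * nrm t a} := by
    intro x hx y hy α β hα hβ hαβ
    simp only [Set.mem_setOf_eq] at *
    rw [← Complex.coe_smul, ← Complex.coe_smul, mul_add, mul_smul_comm, mul_smul_comm, map_add,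
      map_smul, map_smul]
    simp
    have : β = 1 - α := by linarith
    subst this
    nlinarith
  have : orb a ⊆ {s : B | (t (m * s)).re ≤ (t (m * a)).re + r * nrm t a} := by
    refine convexHull_min ?_ hconv
    rintro _ ⟨u, hu, rfl⟩
    simp only [Set.mem_setOf_eq]
    have h1 : t (m * (star u * a * u)) = t (m * a) + t (u * (m * star u - star u * m) * a) := by
      rw [← map_add, show m * (star u * a * u) = (m * star u * a) * u by noncomm_ring, ht]
      congr 1
      have : u * star u = 1 := Unitary.mul_star_self_of_mem hu
      rw [mul_sub, sub_mul, ← mul_assoc u (star u) m, this]; noncomm_ring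
    have h2 := cs t (star (u * (m * star u - star u * m))) a
    rw [star_star, nrm_star t ht, nrm_unitary_left t hu] at h2
    have h3 := (Complex.re_le_norm _).trans h2
    have h4 := mul_le_mul_of_nonneg_right (hm _ (Unitary.star_mem hu)) (nrm_nonneg t a)
    rw [h1, Complex.add_re]
    linarith
  have := this hs
  simp only [Set.mem_setOf_eq] at this
  linarith

lemma comm_const (ht : ∀ x y, t (x * y) = t (y * x)) (a : B) : ∃ c : ℝ, 0 ≤ c ∧ ∀ (m : B) (r : ℝ),
    (∀ u ∈ unitary B, nrm t (m * u - u * m) ≤ r) → nrm t (m * a - a * m) ≤ c * r := by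
  have hmem : a ∈ Submodule.span ℂ (unitary B : Set B) := by
    rw [CStarAlgebra.span_unitary]; trivial
  induction hmem using Submodule.span_induction with
  | mem x h => exact ⟨1, zero_le_one, fun m r hr => by simpa using hr x h⟩
  | zero => exact ⟨0, le_rfl, fun m r hr => by simp [nrm_zero]⟩
  | add x y _ _ hx hy =>
    obtain ⟨c, hc, h⟩ := hx
    obtain ⟨c', hc', h'⟩ := hy
    refine ⟨c + c', by positivity, fun m r hr => ?_⟩
    have := nrm_add t (m * x - x * m) (m * y - y * m)
    rw [show m * (x + y) - (x + y) * m = (m * x - x * m) + (m * y - y * m) by noncomm_ring]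
    linarith [h m r hr, h' m r hr]
  | smul z x _ hx =>
    obtain ⟨c, hc, h⟩ := hx
    refine ⟨‖z‖ * c, by positivity, fun m r hr => ?_⟩
    rw [mul_smul_comm, smul_mul_assoc, ← smul_sub, nrm_smul, mul_assoc]
    exact mul_le_mul_of_nonneg_left (h m r hr) (norm_nonneg _)

end riesz

end MaxMix

namespace MaxMix

open Filter Topology

section mixing

variable {B : Type u} [CStarAlgebra B] [PartialOrder B] [StarOrderedRing B]
variable (t : B →ₚ[ℂ] ℂ)

lemma close_orbits (ht : ∀ x y, t (x * y) = t (y * x)) {σ σ' : B →L[ℂ] ℂ} {C : ℝ} (hC0 : 0 ≤ C)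
    (hC : ∀ x, ‖σ x‖ ≤ C * nrm t x) (hC' : ∀ x, ‖σ' x‖ ≤ C * nrm t x)
    (hφ : ∀ m, ∀ η > 0, ∃ (n : ℕ) (c : Fin n → B), (∑ i, star (c i) * c i) = 1 ∧
      (∀ x, ‖∑ i, σ (star (c i) * x * c i)‖ ≤ C * nrm t x) ∧
      ‖σ' m - ∑ i, σ (star (c i) * m * c i)‖ < η)
    {a b : B} {δ : ℝ} (hδ : 0 < δ)
    (ha : ∀ x, ‖σ x - t (a * x)‖ ≤ δ * nrm t x) (hb : ∀ x, ‖σ' x - t (b * x)‖ ≤ δ * nrm t x)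
    (hasa : IsSelfAdjoint a) (hbsa : IsSelfAdjoint b) :
    ∃ s ∈ orb a, ∃ s' ∈ orb b, nrm t (s - s') ≤ 3 * δ := by
  by_contra hcon
  push Not at hcon
  let K : Set B := {m | ∃ s ∈ orb a, ∃ s' ∈ orb b, m = s - s'}
  let d := sInf (nrm t '' K)
  have hne : (nrm t '' K).Nonempty :=
    ⟨_, _, ⟨a, self_mem_orb a, b, self_mem_orb b, rfl⟩, rfl⟩
  have hbdd : BddBelow (nrm t '' K) := ⟨0, by rintro _ ⟨m, -, rfl⟩; exact nrm_nonneg _ _⟩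
  have hd : 3 * δ ≤ d := by
    apply le_csInf hne
    rintro _ ⟨_, ⟨s, hs, s', hs', rfl⟩, rfl⟩
    exact (hcon s hs s' hs').le
  have hdle : ∀ m ∈ K, d ≤ nrm t m := fun m hm => csInf_le hbdd ⟨m, hm, rfl⟩
  have hex : ∀ κ > 0, ∃ m ∈ K, nrm t m ^ 2 ≤ d ^ 2 + κ := by
    intro κ hκ
    have : d < √(d ^ 2 + κ) := by
      apply Real.lt_sqrt_of_sq_lt; linarith
    obtain ⟨_, ⟨m, hm, rfl⟩, h⟩ := exists_lt_of_csInf_lt hne this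
    refine ⟨m, hm, ?_⟩
    have h2 := Real.sq_sqrt (show 0 ≤ d ^ 2 + κ by positivity)
    nlinarith [nrm_nonneg t m, Real.sqrt_nonneg (d ^ 2 + κ)]
  have hmid : ∀ m ∈ K, ∀ m' ∈ K, ∀ κ > 0, nrm t m ^ 2 ≤ d ^ 2 + κ → nrm t m' ^ 2 ≤ d ^ 2 + κ →
      nrm t (m - m') ≤ 2 * √κ := by
    rintro _ ⟨s, hs, s', hs', rfl⟩ _ ⟨r, hr, r', hr', rfl⟩ κ hκ h1 h2
    set m := s - s'
    set m' := r - r'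
    have hK : (2⁻¹ : ℂ) • (m + m') ∈ K := by
      refine ⟨(2⁻¹ : ℝ) • s + (2⁻¹ : ℝ) • r, ?_, (2⁻¹ : ℝ) • s' + (2⁻¹ : ℝ) • r', ?_, ?_⟩
      · exact (convex_convexHull ℝ _) hs hr (by norm_num) (by norm_num) (by norm_num)
      · exact (convex_convexHull ℝ _) hs' hr' (by norm_num) (by norm_num) (by norm_num)
      · simp only [m, m', ← Complex.coe_smul]
        push_cast
        module
    have h3 := hdle _ hK
    rw [nrm_smul] at h3
    simp at h3
    have h4 := parallelogram t m m'
    have h5 : (2 * d) ^ 2 ≤ nrm t (m + m') ^ 2 := by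
      gcongr
      · linarith
      · linarith
    have h6 : nrm t (m - m') ^ 2 ≤ (2 * √κ) ^ 2 := by
      rw [mul_pow, Real.sq_sqrt hκ.le]; linarith
    exact (sq_le_sq₀ (nrm_nonneg _ _) (by positivity)).mp h6
  have hcent : ∀ m ∈ K, ∀ κ > 0, nrm t m ^ 2 ≤ d ^ 2 + κ → ∀ u ∈ unitary B,
      nrm t (m * u - u * m) ≤ 2 * √κ := by
    intro m hm κ hκ h1 u hu
    have hK : star u * m * u ∈ K := by
      obtain ⟨s, hs, s', hs', rfl⟩ := hm
      exact ⟨_, orb_conj hs hu, _, orb_conj hs' hu, by noncomm_ring⟩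
    have hn : nrm t (star u * m * u) = nrm t m := by
      rw [nrm_unitary_right t ht hu, nrm_unitary_left t (Unitary.star_mem hu)]
    have := hmid _ hK _ hm κ hκ (by rw [hn]; exact h1) h1
    rw [← nrm_unitary_left t hu] at this
    convert this using 2
    rw [mul_sub, ← mul_assoc, ← mul_assoc, Unitary.mul_star_self_of_mem hu, one_mul]
  have main : ∀ κ > 0, d ^ 2 ≤ 2 * δ * √(d ^ 2 + κ) +
      (2 * √κ * (nrm t a + nrm t b) + 2 * κ + 4 * C * √κ) := by
    intro κ hκ
    obtain ⟨m, hm, hmn⟩ := hex κ hκ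
    obtain ⟨n, c, hc1, hcC, hcm⟩ := hφ m κ hκ
    choose k hk0 hk using fun i => comm_const t ht (c i)
    let L : ℝ := C * ∑ i, ‖star (c i)‖ * k i
    have hL : 0 ≤ L := mul_nonneg hC0 (Finset.sum_nonneg fun i _ =>
      mul_nonneg (norm_nonneg _) (hk0 i))
    obtain ⟨κ', hκ', hκκ, hκL⟩ : ∃ κ' > 0, κ' ≤ κ ∧ L * (2 * √κ') ≤ κ := by
      have hr : 0 < κ / (2 * L + 1) := by positivity
      refine ⟨min κ ((κ / (2 * L + 1)) ^ 2), by positivity, min_le_left _ _, ?_⟩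
      have : √(min κ ((κ / (2 * L + 1)) ^ 2)) ≤ κ / (2 * L + 1) := by
        rw [← Real.sqrt_sq hr.le]
        apply Real.sqrt_le_sqrt
        rw [Real.sqrt_sq hr.le]
        exact min_le_right _ _
      calc L * (2 * √(min κ ((κ / (2 * L + 1)) ^ 2))) ≤ L * (2 * (κ / (2 * L + 1))) := by gcongr
        _ = κ * (2 * L / (2 * L + 1)) := by ring
        _ ≤ κ * 1 := by
          gcongr
          rw [div_le_one (by positivity)]; linarith
        _ = κ := mul_one _
    obtain ⟨m', hm', hmn'⟩ := hex κ' hκ'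
    have hdist := hmid m hm m' hm' κ hκ hmn (by linarith)
    have hcen := hcent m' hm' κ' hκ' hmn'
    have hsq : √κ' ≤ √κ := Real.sqrt_le_sqrt hκκ
    -- (1)
    have e1 : (σ' m').re ≥ (∑ i, σ (star (c i) * m' * c i)).re - (κ + 4 * C * √κ) := by
      have h1 := hC' (m - m')
      have h2 := hcC (m - m')
      have h3 : C * nrm t (m - m') ≤ C * (2 * √κ) := by gcongr
      have h4 : ∑ i, σ (star (c i) * (m - m') * c i) = ∑ i, σ (star (c i) * m * c i) -
          ∑ i, σ (star (c i) * m' * c i) := by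
        rw [← Finset.sum_sub_distrib]
        refine Finset.sum_congr rfl fun i _ => ?_
        rw [mul_sub, sub_mul, map_sub]
      rw [h4] at h2
      rw [map_sub] at h1
      have h5 := (Complex.abs_re_le_norm _).trans h1
      have h6 := (Complex.abs_re_le_norm _).trans h2
      have h7 := (Complex.abs_re_le_norm _).trans hcm.le
      rw [Complex.sub_re, abs_le] at h5 h6 h7
      linarith
    have e2 : (∑ i, σ (star (c i) * m' * c i)).re ≥ (σ m').re - κ := by
      have h1 : ∑ i, σ (star (c i) * m' * c i) - σ m' =
          σ (∑ i, star (c i) * (m' * c i - c i * m')) := by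
        rw [map_sum]
        simp_rw [mul_sub, map_sub]
        rw [Finset.sum_sub_distrib]
        congr 1
        · refine Finset.sum_congr rfl fun i _ => ?_
          rw [mul_assoc]
        · rw [← map_sum]
          simp_rw [← mul_assoc]
          rw [← Finset.sum_mul, hc1, one_mul]
      have h2 : ‖σ (∑ i, star (c i) * (m' * c i - c i * m'))‖ ≤ κ := by
        refine (hC _).trans (le_trans ?_ hκL)
        rw [show L * (2 * √κ') = C * ∑ i, ‖star (c i)‖ * (k i * (2 * √κ')) by
          simp only [L]; rw [mul_assoc, Finset.sum_mul]; simp_rw [mul_assoc]]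
        refine mul_le_mul_of_nonneg_left ?_ hC0
        refine (nrm_sum _ _ _).trans (Finset.sum_le_sum fun i _ => ?_)
        refine (nrm_mul_left _ _ _).trans ?_
        exact mul_le_mul_of_nonneg_left (hk i m' _ hcen) (norm_nonneg _)
      rw [← h1] at h2
      have h3 := (Complex.abs_re_le_norm _).trans h2
      rw [Complex.sub_re, abs_le] at h3
      linarith
    have e3 : nrm t m' ^ 2 ≤ (t (m' * a)).re - (t (m' * b)).re +
        2 * √κ * (nrm t a + nrm t b) := by
      obtain ⟨s, hs, s', hs', rfl⟩ := hm'
      set m' := s - s'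
      have hsa : star m' = m' := by
        simp only [m', star_sub, (orb_sa hasa hs).star_eq, (orb_sa hbsa hs').star_eq]
      have h1 := orb_trace t ht hs hcen
      have h2 := orb_trace (m := -m') t ht hs' (r := 2 * √κ') (fun u hu => by
        have := hcen u hu
        rw [← nrm_neg] at this
        convert this using 2
        noncomm_ring)
      simp only [neg_mul, map_neg, Complex.neg_re] at h2
      rw [nrm_sq, hsa]
      have h3 : (t (m' * m')).re = (t (m' * s)).re - (t (m' * s')).re := by
        rw [← Complex.sub_re, ← map_sub, ← mul_sub]
      have h4 := mul_le_mul_of_nonneg_right hsq (nrm_nonneg t a)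
      have h5 := mul_le_mul_of_nonneg_right hsq (nrm_nonneg t b)
      rw [h3]
      linarith
    have e4 : (t (m' * a)).re - (t (m' * b)).re ≤ (σ m').re - (σ' m').re + 2 * δ * nrm t m' := by
      have h1 := (Complex.abs_re_le_norm _).trans (ha m')
      have h2 := (Complex.abs_re_le_norm _).trans (hb m')
      rw [Complex.sub_re, abs_le] at h1 h2
      rw [ht m' a, ht m' b]
      linarith
    have e5 : nrm t m' ≤ √(d ^ 2 + κ) := by
      apply Real.le_sqrt_of_sq_le; linarith
    have e6 : 2 * δ * nrm t m' ≤ 2 * δ * √(d ^ 2 + κ) := by gcongr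
    have e7 : d ^ 2 ≤ nrm t m' ^ 2 := by
      gcongr
      · linarith
      · exact hdle _ hm'
    linarith
  have hlim : Tendsto (fun κ : ℝ => 2 * δ * √(d ^ 2 + κ) +
      (2 * √κ * (nrm t a + nrm t b) + 2 * κ + 4 * C * √κ)) (𝓝[>] 0)
      (𝓝 (2 * δ * √(d ^ 2 + 0) + (2 * √0 * (nrm t a + nrm t b) + 2 * 0 + 4 * C * √0))) := by
    apply tendsto_nhdsWithin_of_tendsto_nhds
    apply Continuous.tendsto (f := fun κ : ℝ => 2 * δ * √(d ^ 2 + κ) +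
      (2 * √κ * (nrm t a + nrm t b) + 2 * κ + 4 * C * √κ))
    fun_prop
  have := ge_of_tendsto hlim (eventually_nhdsWithin_of_forall fun κ hκ => main κ hκ)
  rw [add_zero, Real.sqrt_sq (by linarith)] at this
  simp at this
  nlinarith

/-- the elementary map with coefficients `c` -/
def elem {ι : Type} [Fintype ι] (c : ι → B) : B →L[ℂ] B :=
  ∑ i, ContinuousLinearMap.mulLeftRight ℂ B (star (c i)) (c i)

lemma elem_apply {ι : Type} [Fintype ι] (c : ι → B) (x : B) :
    elem c x = ∑ i, star (c i) * x * c i := by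
  simp [elem, ContinuousLinearMap.sum_apply]

lemma elem_ucp {ι : Type} [Fintype ι] (c : ι → B) (hc : ∑ i, star (c i) * c i = 1) :
    IsElementaryUCP (elem c) := by
  refine ⟨Fintype.card ι, fun k => c ((Fintype.equivFin ι).symm k), ?_, fun x => ?_⟩
  · rw [← hc]
    exact (Fintype.equivFin ι).symm.sum_comp (fun i => star (c i) * c i)
  · rw [elem_apply]
    exact ((Fintype.equivFin ι).symm.sum_comp (fun i => star (c i) * x * c i)).symm

lemma ucp_comp {φ ψ : B →L[ℂ] B} (hφ : IsElementaryUCP φ) (hψ : IsElementaryUCP ψ) :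
    IsElementaryUCP (φ.comp ψ) := by
  obtain ⟨n, a, ha, hφ⟩ := hφ
  obtain ⟨k, b, hb, hψ⟩ := hψ
  have hx : ∀ x, ∑ p : Fin n × Fin k, star (b p.2 * a p.1) * x * (b p.2 * a p.1) =
      φ (ψ x) := by
    intro x
    rw [Fintype.sum_prod_type, hφ, hψ]
    refine Finset.sum_congr rfl fun i _ => ?_
    rw [Finset.mul_sum, Finset.sum_mul]
    refine Finset.sum_congr rfl fun j _ => ?_
    rw [star_mul]; noncomm_ring
  have h1 : ∑ p : Fin n × Fin k, star (b p.2 * a p.1) * (b p.2 * a p.1) = 1 := by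
    have := hx 1
    simp only [mul_one] at this
    rw [this, hφ, hψ]
    simp [ha, hb]
  convert elem_ucp _ h1 using 1
  ext x
  rw [elem_apply, hx]; rfl

lemma ucp_norm {φ : B →L[ℂ] B} (hφ : IsElementaryUCP φ) (t : B →ₚ[ℂ] ℂ) (x : B) :
    ‖t (φ x)‖ ≤ ‖x‖ * (t 1).re := by
  obtain ⟨n, a, ha, h⟩ := hφ
  rw [h, ← ha, map_sum, map_sum, Complex.re_sum, Finset.mul_sum]
  exact (norm_sum_le _ _).trans (Finset.sum_le_sum fun i _ => conj_bound _ _ _)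

lemma orb_unpack {a s : B} (hs : s ∈ orb a) : ∃ (ι : Type) (_ : Fintype ι) (c : ι → B),
    s = ∑ i, star (c i) * a * c i ∧ ∑ i, star (c i) * c i = 1 ∧ ∑ i, c i * star (c i) = 1 := by
  obtain ⟨ι, hι, w, z, hw0, hw1, hz, hsum⟩ := mem_convexHull_iff_exists_fintype.mp hs
  choose u hu hz using hz
  let e := Fintype.equivFin ι
  refine ⟨Fin (Fintype.card ι), inferInstance,
    fun k => ((√(w (e.symm k)) : ℝ) : ℂ) • u (e.symm k), ?_, ?_, ?_⟩
  all_goals simp only [star_smul, smul_mul_assoc, mul_smul_comm, smul_smul]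
  all_goals simp only [Complex.star_def, Complex.conj_ofReal, ← Complex.ofReal_mul,
    Real.mul_self_sqrt (hw0 _), Complex.coe_smul]
  · rw [e.symm.sum_comp (fun i => w i • (star (u i) * a * u i)), ← hsum]
    exact Finset.sum_congr rfl fun i _ => by rw [hz]
  · rw [e.symm.sum_comp (fun i => w i • (star (u i) * u i))]
    simp only [Unitary.star_mul_self_of_mem (hu _)]
    rw [← Finset.sum_smul, hw1, one_smul]
  · rw [e.symm.sum_comp (fun i => w i • (u i * star (u i)))]
    simp only [Unitary.mul_star_self_of_mem (hu _)]
    rw [← Finset.sum_smul, hw1, one_smul]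

end mixing

end MaxMix

namespace MaxMix

open Filter Topology

section propB

variable {B : Type u} [CStarAlgebra B] [PartialOrder B] [StarOrderedRing B]
variable (t : B →ₚ[ℂ] ℂ)

lemma exists_inv_sqrt {s : B} (hs : 0 ≤ s) {ε : ℝ} (hε : 0 < ε) :
    ∃ g : B, IsSelfAdjoint g ∧ g * s * g + (ε : ℂ) • (g * g) = 1 := by
  have hsa : IsSelfAdjoint s := IsSelfAdjoint.of_nonneg hs
  have hsp : ∀ x ∈ spectrum ℝ s, 0 ≤ x := fun x hx => spectrum_nonneg_of_nonneg hs hx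
  have hc : ContinuousOn (fun x : ℝ => (√(x + ε))⁻¹) (spectrum ℝ s) := by
    apply ContinuousOn.inv₀
    · fun_prop
    · intro x hx
      have := hsp x hx
      positivity
  refine ⟨cfc (fun x : ℝ => (√(x + ε))⁻¹) s, IsSelfAdjoint.cfc, ?_⟩
  set f : ℝ → ℝ := fun x : ℝ => (√(x + ε))⁻¹
  have h1 : cfc f s * s * cfc f s = cfc (fun x => f x * x * f x) s := by
    rw [cfc_mul (fun x => f x * x) f s (hc.mul continuousOn_id) hc,
      cfc_mul f (fun x => x) s hc continuousOn_id, cfc_id' ℝ s]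
  have h2 : (ε : ℂ) • (cfc f s * cfc f s) = cfc (fun x => ε * (f x * f x)) s := by
    rw [cfc_const_mul ε (fun x => f x * f x) s (hc.mul hc), cfc_mul f f s hc hc]
    exact Complex.coe_smul _ _
  rw [h1, h2, ← cfc_add s (fun x => f x * x * f x) (fun x => ε * (f x * f x)) ((hc.mul continuousOn_id).mul hc) (continuousOn_const.mul (hc.mul hc)),
    ← cfc_const_one ℝ s]
  apply cfc_congr
  intro x hx
  have := hsp x hx
  have h3 : 0 < √(x + ε) := by positivity
  have h4 : √(x + ε) * √(x + ε) = x + ε := Real.mul_self_sqrt (by positivity)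
  simp only [f]
  field_simp
  rw [sq, h4]

lemma unmix (ht : ∀ x y, t (x * y) = t (y * x)) (h1 : t 1 = 1) {a s : B} (ha : 0 ≤ a)
    (hs : s ∈ orb a) {ε : ℝ} (hε : 0 < ε) :
    ∃ ψ : B →L[ℂ] B, IsElementaryUCP ψ ∧ ∀ x, ‖t (s * ψ x) - t (a * x)‖ ≤ 2 * ε * ‖x‖ := by
  obtain ⟨ι, hι, c, hsc, -, hc⟩ := orb_unpack hs
  have hk0 : 0 ≤ CFC.sqrt a := CFC.sqrt_nonneg a
  have hkk : CFC.sqrt a * CFC.sqrt a = a := CFC.sqrt_mul_sqrt_self a ha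
  set k := CFC.sqrt a
  have hk : star k = k := (IsSelfAdjoint.of_nonneg hk0).star_eq
  have hs0 : 0 ≤ s := by
    rw [hsc]
    exact Finset.sum_nonneg fun i _ => star_left_conjugate_nonneg ha _
  obtain ⟨g, hg, hgs⟩ := exists_inv_sqrt hs0 hε
  have hgst : star g = g := hg.star_eq
  let v : ι → B := fun j => k * c j * g
  have hv : ∑ j, star (v j) * v j = g * s * g := by
    rw [hsc, Finset.mul_sum, Finset.sum_mul]
    refine Finset.sum_congr rfl fun i _ => ?_
    simp only [v, star_mul, hk, hgst]
    rw [← hkk]; noncomm_ring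
  have hvt : (∑ j, (t (star (v j) * v j)).re) ≤ 1 := by
    rw [← Complex.re_sum, ← map_sum, hv, eq_sub_of_add_eq hgs, map_sub, h1, map_smul]
    have : 0 ≤ (t (g * g)).re := by
      have := plm_nonneg t (star_mul_self_nonneg g)
      rwa [hgst] at this
    simp [Complex.sub_re]
    positivity
  have hvx : ∀ x, ‖∑ j, t (star (v j) * x * v j)‖ ≤ ‖x‖ := fun x => by
    refine (norm_sum_le _ _).trans ((Finset.sum_le_sum fun i _ => conj_bound _ _ _).trans ?_)
    rw [← Finset.mul_sum]
    exact mul_le_of_le_one_right (norm_nonneg _) hvt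
  have hvx' : ∀ x, ‖∑ j, t (v j * x * star (v j))‖ ≤ ‖x‖ := fun x => by
    have := fun j => conj_bound t (star (v j)) x
    simp only [star_star] at this
    refine (norm_sum_le _ _).trans ((Finset.sum_le_sum fun i _ => this i).trans ?_)
    rw [← Finset.mul_sum]
    rw [Finset.sum_congr rfl fun j _ => congrArg Complex.re (ht (v j) (star (v j)))]
    exact mul_le_of_le_one_right (norm_nonneg _) hvt
  let d : Option ι → B := fun o => o.elim (((√ε : ℝ) : ℂ) • g) v
  have hd0 : ∀ x, star (d none) * x * d none = (ε : ℂ) • (g * x * g) := fun x => by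
    simp only [d, Option.elim, star_smul, smul_mul_assoc, mul_smul_comm, smul_smul, hgst]
    simp only [Complex.star_def, Complex.conj_ofReal, ← Complex.ofReal_mul,
      Real.mul_self_sqrt hε.le]
  have hd : ∑ o, star (d o) * d o = 1 := by
    rw [Fintype.sum_option]
    have := hd0 1
    rw [mul_one, mul_one] at this
    rw [this, add_comm]
    change ∑ j, star (v j) * v j + _ = 1
    rw [hv, hgs]
  refine ⟨elem d, elem_ucp d hd, fun x => ?_⟩
  rw [elem_apply, Fintype.sum_option, hd0, mul_add, map_add]
  have e1 : t (s * (ε : ℂ) • (g * x * g)) = ε * ∑ j, t (v j * x * star (v j)) := by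
    rw [mul_smul_comm, map_smul, smul_eq_mul]
    congr 1
    rw [show s * (g * x * g) = (s * g * x) * g by noncomm_ring, ht,
      show g * (s * g * x) = (g * s * g) * x by noncomm_ring, ← hv, Finset.sum_mul, map_sum]
    refine Finset.sum_congr rfl fun j _ => ?_
    rw [mul_assoc, ht]
  have e2 : t (s * ∑ j, star (d (some j)) * x * d (some j)) =
      t (a * x) - ε * ∑ j, t (star (v j) * x * v j) := by
    let W := ∑ j, star (c j) * k * x * k * c j
    have hW : ∑ j, star (v j) * x * v j = g * W * g := by
      simp only [W]
      rw [Finset.mul_sum, Finset.sum_mul]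
      refine Finset.sum_congr rfl fun i _ => ?_
      simp only [v, star_mul, hk, hgst]
      noncomm_ring
    have htW : t W = t (a * x) := by
      simp only [W, map_sum]
      have : ∀ j, t (star (c j) * k * x * k * c j) = t (k * x * k * (c j * star (c j))) := by
        intro j
        rw [show star (c j) * k * x * k * c j = star (c j) * (k * x * k * c j) by noncomm_ring, ht]
        congr 1; noncomm_ring
      simp_rw [this]
      rw [← map_sum, ← Finset.mul_sum, hc, mul_one, ht, ← mul_assoc, hkk]
    rw [← map_sum, hW]
    change t (s * ∑ j, star (v j) * x * v j) = _
    rw [hW, show s * (g * W * g) = (s * g * W) * g by noncomm_ring, ht,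
      show g * (s * g * W) = (g * s * g) * W by noncomm_ring, eq_sub_of_add_eq hgs, sub_mul, one_mul,
      map_sub, htW, smul_mul_assoc, map_smul, smul_eq_mul, mul_assoc g g W, ht g (g * W)]
  rw [e1, e2]
  have := hvx x
  have := hvx' x
  calc _ = ‖(ε : ℂ) * ∑ j, t (v j * x * star (v j)) - ε * ∑ j, t (star (v j) * x * v j)‖ := by
        congr 1; ring
    _ ≤ ε * ‖x‖ + ε * ‖x‖ := by
      refine (norm_sub_le _ _).trans ?_
      rw [norm_mul, norm_mul, Complex.norm_real, Real.norm_of_nonneg hε.le]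
      gcongr
    _ = _ := by ring

lemma premix (ht : ∀ x y, t (x * y) = t (y * x)) {b s : B}
    (hs : s ∈ orb b) :
    ∃ ψ : B →L[ℂ] B, IsElementaryUCP ψ ∧ ∀ x, t (b * ψ x) = t (s * x) := by
  obtain ⟨ι, hι, c, hsc, -, hc⟩ := orb_unpack hs
  refine ⟨elem fun i => star (c i), elem_ucp _ (by simpa using hc), fun x => ?_⟩
  rw [elem_apply, hsc, Finset.mul_sum, Finset.sum_mul, map_sum, map_sum]
  refine Finset.sum_congr rfl fun i _ => ?_
  rw [star_star, show b * (c i * x * star (c i)) = (b * c i * x) * star (c i) by noncomm_ring, ht]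
  congr 1; noncomm_ring

lemma norm_le_of_states {x : B} (hx : 0 ≤ x) {r : ℝ} (h : x ≤ algebraMap ℝ B r) (hr : 0 ≤ r) :
    ‖x‖ ≤ r := by
  exact (CStarAlgebra.norm_le_iff_le_algebraMap x hr hx).2 h

/-- elementary ucp maps are contractive -/
lemma ucp_contr {φ : B →L[ℂ] B} (hφ : IsElementaryUCP φ) (x : B) : ‖φ x‖ ≤ ‖x‖ := by
  obtain ⟨n, a, ha, h⟩ := hφ
  -- Kadison: φ(x)* φ(x) ≤ φ(x* x)
  have hx : φ (star x * x) - star (φ x) * φ x =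
      ∑ i, star (x * a i - a i * φ x) * (x * a i - a i * φ x) := by
    have e : ∀ i, star (x * a i - a i * φ x) * (x * a i - a i * φ x) =
        star (a i) * (star x * x) * a i - (star (a i) * star x * a i) * φ x
        - star (φ x) * (star (a i) * x * a i) + star (φ x) * (star (a i) * a i) * φ x := by
      intro i
      simp only [star_sub, star_mul]; noncomm_ring
    simp_rw [e]
    rw [Finset.sum_add_distrib, Finset.sum_sub_distrib, Finset.sum_sub_distrib, ← Finset.sum_mul,
      ← Finset.mul_sum, ← Finset.sum_mul, ← Finset.mul_sum, ha, ← h, ← h, ← h]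
    have : star (φ x) = φ (star x) := by
      rw [h, h, star_sum]
      refine Finset.sum_congr rfl fun i _ => ?_
      simp [star_mul, mul_assoc]
    rw [this]; noncomm_ring
  have h1 : star (φ x) * φ x ≤ φ (star x * x) := by
    rw [← sub_nonneg, hx]
    exact Finset.sum_nonneg fun i _ => star_mul_self_nonneg _
  have h2 : φ (star x * x) ≤ algebraMap ℝ B (‖x‖ ^ 2) := by
    have h3 : star x * x ≤ algebraMap ℝ B (‖x‖ ^ 2) := CStarAlgebra.star_mul_le_algebraMap_norm_sq
    have h4 : algebraMap ℝ B (‖x‖ ^ 2) = ∑ i, star (a i) * algebraMap ℝ B (‖x‖ ^ 2) * a i := by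
      simp_rw [← Algebra.commutes, mul_assoc]
      rw [← Finset.mul_sum, ha, mul_one]
    rw [h4, h]
    exact Finset.sum_le_sum fun i _ => star_left_conjugate_le_conjugate h3 _
  have h3 := norm_le_of_states (star_mul_self_nonneg (φ x)) (h1.trans h2) (by positivity)
  rw [CStarRing.norm_star_mul_self, ← sq] at h3
  exact (sq_le_sq₀ (norm_nonneg _) (norm_nonneg _)).mp h3

theorem propB (ht : ∀ x y, t (x * y) = t (y * x)) (h1 : t 1 = 1) {σ σ' : B →L[ℂ] ℂ}
    (hσ : IsPositiveFunctional σ) (hσ' : IsPositiveFunctional σ') {C : ℝ} (hC0 : 0 ≤ C)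
    (hC : ∀ x, ‖σ x‖ ≤ C * nrm t x) (hC' : ∀ x, ‖σ' x‖ ≤ C * nrm t x)
    (hφ : ∀ m, ∀ η > 0, ∃ (n : ℕ) (c : Fin n → B), (∑ i, star (c i) * c i) = 1 ∧
      (∀ x, ‖∑ i, σ (star (c i) * x * c i)‖ ≤ C * nrm t x) ∧
      ‖σ' m - ∑ i, σ (star (c i) * m * c i)‖ < η) {δ : ℝ} (hδ : 0 < δ) :
    ∃ ψ : B →L[ℂ] B, IsElementaryUCP ψ ∧ ∀ x, ‖σ x - σ' (ψ x)‖ ≤ δ * ‖x‖ := by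
  have hn1 : nrm t 1 = 1 := by
    have := nrm_sq t 1
    simp [h1] at this
    rcases this with h | h
    · exact h
    · linarith [nrm_nonneg t 1]
  have hle : ∀ x, nrm t x ≤ ‖x‖ := fun x => by simpa [hn1] using nrm_le t x
  obtain ⟨a, ha0, ha⟩ := riesz_pos t ht σ hσ hC0 hC (show 0 < δ / 7 by positivity)
  obtain ⟨b, hb0, hb⟩ := riesz_pos t ht σ' hσ' hC0 hC' (show 0 < δ / 7 by positivity)
  obtain ⟨s, hs, s', hs', hss⟩ := close_orbits t ht hC0 hC hC' hφ (show 0 < δ / 7 by positivity)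
    ha hb (IsSelfAdjoint.of_nonneg ha0) (IsSelfAdjoint.of_nonneg hb0)
  obtain ⟨ψ2, hψ2, h2⟩ := unmix t ht h1 ha0 hs (show 0 < δ / 14 by positivity)
  obtain ⟨ψ1, hψ1, h3⟩ := premix t ht hs'
  refine ⟨ψ1.comp ψ2, ucp_comp hψ1 hψ2, fun x => ?_⟩
  rw [ContinuousLinearMap.comp_apply]
  have e1 := (hb (ψ1 (ψ2 x))).trans (mul_le_mul_of_nonneg_left
    ((hle _).trans ((ucp_contr hψ1 _).trans (ucp_contr hψ2 _))) (by positivity))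
  rw [h3] at e1
  have e2 := (ha x).trans (mul_le_mul_of_nonneg_left (hle _) (by positivity))
  have e3 := h2 x
  have e4 : ‖t (s * ψ2 x) - t (s' * ψ2 x)‖ ≤ 3 * (δ / 7) * ‖x‖ := by
    rw [← map_sub, ← sub_mul]
    have hsa : star (s - s') = s - s' := by
      rw [star_sub, (orb_sa (IsSelfAdjoint.of_nonneg ha0) hs).star_eq,
        (orb_sa (IsSelfAdjoint.of_nonneg hb0) hs').star_eq]
    have := cs t (s - s') (ψ2 x)
    rw [hsa] at this
    exact this.trans (mul_le_mul hss ((hle _).trans (ucp_contr hψ2 _)) (nrm_nonneg _ _)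
      (by positivity))
  have : σ x - σ' (ψ1 (ψ2 x)) = (σ x - t (a * x)) - (t (s * ψ2 x) - t (a * x))
      + (t (s * ψ2 x) - t (s' * ψ2 x)) - (σ' (ψ1 (ψ2 x)) - t (s' * ψ2 x)) := by ring
  rw [this]
  refine (norm_sub_le _ _).trans ?_
  have e5 := norm_add_le ((σ x - t (a * x)) - (t (s * ψ2 x) - t (a * x)))
    (t (s * ψ2 x) - t (s' * ψ2 x))
  have e6 := norm_sub_le (σ x - t (a * x)) (t (s * ψ2 x) - t (a * x))
  have e7 : 0 ≤ δ * ‖x‖ := by positivity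
  linarith

end propB

end MaxMix

namespace MaxMix

open Filter Topology

section GN

variable {B : Type u} [CStarAlgebra B] [PartialOrder B] [StarOrderedRing B]

lemma state_bound {σ : B →L[ℂ] ℂ} (hσ : IsState σ) (x : B) : ‖σ x‖ ≤ ‖x‖ := by
  have := plm_bound (toPLM σ hσ.1) x
  simpa [toPLM_apply, hσ.2] using this

lemma ulim {X : Type*} (U : Ultrafilter X) (f : X → B →L[ℂ] ℂ)
    (hf : ∀ᶠ i in U, ∀ x, ‖f i x‖ ≤ ‖x‖) :
    ∃ g : B →L[ℂ] ℂ, ∀ x, Tendsto (fun i => f i x) U (𝓝 (g x)) := by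
  have h : ∀ x, ∃ z, Tendsto (fun i => f i x) U (𝓝 z) := fun x => by
    have := (isCompact_closedBall (0 : ℂ) ‖x‖).ultrafilter_le_nhds (U.map fun i => f i x) (by
      rw [Ultrafilter.coe_map, le_principal_iff, mem_map]
      filter_upwards [hf] with i hi
      simpa using hi x)
    obtain ⟨z, -, hz⟩ := this
    exact ⟨z, hz⟩
  choose g hg using h
  refine ⟨LinearMap.mkContinuous ⟨⟨g, fun x y => ?_⟩, fun c x => ?_⟩ 1 fun x => ?_, hg⟩
  · refine tendsto_nhds_unique (hg (x + y)) ?_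
    simpa using (hg x).add (hg y)
  · refine tendsto_nhds_unique (hg (c • x)) ?_
    simpa using (hg x).const_smul c
  · rw [one_mul]
    refine le_of_tendsto (hg x).norm ?_
    filter_upwards [hf] with i hi using hi x

lemma ulim_state {X : Type*} {U : Ultrafilter X} {f : X → B →L[ℂ] ℂ} {g : B →L[ℂ] ℂ}
    (hf : ∀ᶠ i in U, IsState (f i)) (hg : ∀ x, Tendsto (fun i => f i x) U (𝓝 (g x))) :
    IsState g := by
  refine ⟨fun a => ?_, ?_⟩
  · refine ge_of_tendsto (hg _) ?_
    filter_upwards [hf] with i hi using hi.1 a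
  · refine tendsto_nhds_unique (hg 1) (tendsto_const_nhds.congr' ?_)
    filter_upwards [hf] with i hi using hi.2.symm

/-- tracial states -/
def IsTracial (t : B →L[ℂ] ℂ) : Prop := IsState t ∧ ∀ x y, t (x * y) = t (y * x)

/-- `t` dominates all mixtures of `σ` up to the factor `N`. -/
def Dom (N : ℝ) (σ t : B →L[ℂ] ℂ) : Prop :=
  ∀ φ : B →L[ℂ] B, IsElementaryUCP φ → ∀ x, (σ (φ (star x * x))).re ≤ N * (t (star x * x)).re

/-- states all of whose mixtures are dominated by a multiple of a common tracial state. -/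
def GN (N : ℝ) (σ : B →L[ℂ] ℂ) : Prop :=
  IsState σ ∧ ∃ t : B →L[ℂ] ℂ, IsTracial t ∧ Dom N σ t

lemma ulim_GN {X : Type*} {U : Ultrafilter X} {f : X → B →L[ℂ] ℂ} {g : B →L[ℂ] ℂ} {N : ℝ}
    (hf : ∀ᶠ i in U, GN N (f i)) (hg : ∀ x, Tendsto (fun i => f i x) U (𝓝 (g x))) :
    GN N g := by
  refine ⟨ulim_state (hf.mono fun i h => h.1) hg, ?_⟩
  have : ∀ i, ∃ t : B →L[ℂ] ℂ, GN N (f i) → IsTracial t ∧ Dom N (f i) t := by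
    intro i
    by_cases h : GN N (f i)
    · obtain ⟨t, ht⟩ := h.2
      exact ⟨t, fun _ => ht⟩
    · exact ⟨0, fun h' => (h h').elim⟩
  choose T hT using this
  have hT' : ∀ᶠ i in U, IsTracial (T i) ∧ Dom N (f i) (T i) := hf.mono fun i h => hT i h
  obtain ⟨t, ht⟩ := ulim U T (hT'.mono fun i h x => state_bound h.1.1 x)
  refine ⟨t, ⟨ulim_state (hT'.mono fun i h => h.1.1) ht, fun x y => ?_⟩, fun φ hφ x => ?_⟩
  · refine tendsto_nhds_unique (ht _) ((ht (y * x)).congr' ?_)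
    filter_upwards [hT'] with i hi using (hi.1.2 x y).symm
  · refine le_of_tendsto_of_tendsto ((Complex.continuous_re.tendsto _).comp (hg _))
      (((Complex.continuous_re.tendsto _).comp (ht _)).const_mul N) ?_
    filter_upwards [hT'] with i hi using hi.2 φ hφ x

/-- the pointwise real module structure, preferred to the restriction of scalars -/
instance (priority := 2000) modR : @Module ℝ (WeakDual ℂ B) _
    (WeakDual.instAddCommGroup (𝕜 := ℂ) (E := B)).toAddCommMonoid :=
  WeakDual.instModule' ℝ

/-- pull back a predicate to the weak dual -/
def wset (P : (B →L[ℂ] ℂ) → Prop) : Set (WeakDual ℂ B) := {f | P (WeakDual.toStrongDual f)}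

lemma wset_compact {P : (B →L[ℂ] ℂ) → Prop} (hP : ∀ f, P f → ∀ x, ‖f x‖ ≤ ‖x‖)
    (hU : ∀ (U : Ultrafilter (WeakDual ℂ B)) (g : B →L[ℂ] ℂ),
      (∀ᶠ i in U, P (WeakDual.toStrongDual i)) →
      (∀ x, Tendsto (fun i => WeakDual.toStrongDual i x) U (𝓝 (g x))) → P g) :
    IsCompact (wset P) := by
  rw [isCompact_iff_ultrafilter_le_nhds]
  intro U hUS
  have h1 : ∀ᶠ i in U, P (WeakDual.toStrongDual i) := le_principal_iff.mp hUS
  obtain ⟨g, hg⟩ := ulim U (fun i => WeakDual.toStrongDual i) (h1.mono fun i h x => hP _ h x)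
  refine ⟨StrongDual.toWeakDual g, hU U g h1 hg, ?_⟩
  have : Tendsto (fun i : WeakDual ℂ B => i) U (𝓝 (StrongDual.toWeakDual g)) := by
    rw [tendsto_iff_forall_eval_tendsto_topDualPairing]
    exact hg
  exact this

lemma compact_states : IsCompact (wset (B := B) IsState) :=
  wset_compact (fun _ h x => state_bound h x) fun _ _ h hg => ulim_state h hg

lemma compact_GN (N : ℝ) : IsCompact (wset (B := B) (GN N)) :=
  wset_compact (fun _ h x => state_bound h.1 x) fun _ _ h hg => ulim_GN h hg

lemma state_conv {σ τ : B →L[ℂ] ℂ} (hσ : IsState σ) (hτ : IsState τ) {a b : ℝ} (ha : 0 ≤ a)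
    (hb : 0 ≤ b) (hab : a + b = 1) : IsState (a • σ + b • τ) := by
  refine ⟨fun x => ?_, ?_⟩
  · have h1 := hσ.1 x
    have h2 := hτ.1 x
    simp only [_root_.add_apply, _root_.smul_apply]
    exact add_nonneg (smul_nonneg ha h1) (smul_nonneg hb h2)
  · simp only [_root_.add_apply, _root_.smul_apply, hσ.2, hτ.2]
    rw [← add_smul, hab, one_smul]

lemma GN_conv {σ τ : B →L[ℂ] ℂ} {N : ℝ} (hσ : GN N σ) (hτ : GN N τ) {a b : ℝ} (ha : 0 ≤ a)
    (hb : 0 ≤ b) (hab : a + b = 1) : GN N (a • σ + b • τ) := by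
  obtain ⟨h1, t1, ht1, hd1⟩ := hσ
  obtain ⟨h2, t2, ht2, hd2⟩ := hτ
  refine ⟨state_conv h1 h2 ha hb hab, a • t1 + b • t2,
    ⟨state_conv ht1.1 ht2.1 ha hb hab, fun x y => ?_⟩, fun φ hφ x => ?_⟩
  · simp only [_root_.add_apply, _root_.smul_apply, ht1.2 x y, ht2.2 x y]
  · simp only [_root_.add_apply, _root_.smul_apply, Complex.add_re,
      Complex.smul_re, smul_eq_mul]
    have e1 := mul_le_mul_of_nonneg_left (hd1 φ hφ x) ha
    have e2 := mul_le_mul_of_nonneg_left (hd2 φ hφ x) hb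
    linarith

lemma convex_GN (N : ℝ) : Convex ℝ (wset (B := B) (GN N)) :=
  fun _ hx _ hy _ _ ha hb hab => GN_conv hx hy ha hb hab

instance lcs_wd : LocallyConvexSpace ℝ (WeakDual ℂ B) :=
  inferInstanceAs (LocallyConvexSpace ℝ (WeakBilin (topDualPairing ℂ B)))

/-- separation -/
lemma separate {N : ℝ} {ω : B →L[ℂ] ℂ} {ε : ℝ} (hε : 0 < ε)
    (h : ∀ σ, GN N σ → ¬ ∀ x, ‖ω x - σ x‖ ≤ ε * ‖x‖) :
    ∃ (x : B) (c : ℝ), (∀ σ, GN N σ → (σ x).re ≤ c) ∧ c < (ω x).re - ε * ‖x‖ := by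
  let K : Set (WeakDual ℂ B) := WeakDual.toStrongDual ⁻¹' Metric.closedBall ω ε
  have hK : IsClosed K := WeakDual.isClosed_closedBall ω ε
  have hKc : Convex ℝ K := by
    intro x hx y hy a b ha hb hab
    exact convex_closedBall ω ε hx hy ha hb hab
  have hdisj : Disjoint (wset (B := B) (GN N)) K := by
    rw [Set.disjoint_left]
    intro f hf hfK
    refine h _ hf fun x => ?_
    have h1 : ‖WeakDual.toStrongDual f - ω‖ ≤ ε := by
      rw [← dist_eq_norm]; exact hfK
    have h2 := (WeakDual.toStrongDual f - ω).le_of_opNorm_le h1 x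
    rw [_root_.sub_apply, norm_sub_rev] at h2
    exact h2
  obtain ⟨f, u, v, h1, huv, h2⟩ := RCLike.geometric_hahn_banach_compact_closed (𝕜 := ℂ) (E := WeakDual ℂ B)
    (convex_GN N) (compact_GN N) hKc hK hdisj
  obtain ⟨x, hx⟩ := LinearMap.dualEmbedding_surjective (topDualPairing ℂ B) f
  have hfx : ∀ g : WeakDual ℂ B, f g = WeakDual.toStrongDual g x := by
    intro g
    rw [← hx]; rfl
  refine ⟨x, u, fun σ hσ => ?_, ?_⟩
  · have := h1 (StrongDual.toWeakDual σ) hσ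
    rw [hfx] at this
    exact this.le
  · obtain ⟨g, hg, hgx⟩ := exists_dual_vector'' ℂ x
    have := h2 (StrongDual.toWeakDual (ω - (ε : ℂ) • g)) (by
      change (ω - (ε : ℂ) • g) ∈ Metric.closedBall ω ε
      rw [mem_closedBall_iff_norm']
      change ‖ω - (ω - (ε : ℂ) • g)‖ ≤ ε
      rw [sub_sub_cancel, norm_smul, Complex.norm_real, Real.norm_of_nonneg hε.le]
      exact mul_le_of_le_one_right hε.le hg)
    rw [hfx] at this
    have e : WeakDual.toStrongDual (StrongDual.toWeakDual (ω - (ε : ℂ) • g)) x =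
      ω x - ε * ‖x‖ := by
      change ω x - (ε : ℂ) • g x = _
      rw [hgx]; rfl
    rw [e] at this
    have e2 : (ω x - ε * ‖x‖ : ℂ).re = (ω x).re - ε * ‖x‖ := by
      simp
    have e3 : v < (ω x - ε * ‖x‖ : ℂ).re := this
    linarith

end GN

end MaxMix

namespace MaxMix

open Filter Topology

section reps

variable {B : Type u} [CStarAlgebra B] [PartialOrder B] [StarOrderedRing B]

/-- the data of a representation -/
structure IsRep {K : Type u} [NormedAddCommGroup K] [InnerProductSpace ℂ K] [CompleteSpace K]
    (π : B →L[ℂ] (K →L[ℂ] K)) : Prop where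
  mul : ∀ x y, π (x * y) = π x * π y
  star : ∀ x, π (star x) = star (π x)
  one : π 1 = 1

/-- vector states of representations of dimension at most `N` -/
def VS (N : ℕ) (σ : B →L[ℂ] ℂ) : Prop :=
  ∃ (K : Type u) (_ : NormedAddCommGroup K) (_ : InnerProductSpace ℂ K) (_ : CompleteSpace K)
    (π : B →L[ℂ] (K →L[ℂ] K)) (ξ : K), IsRep π ∧ FiniteDimensional ℂ K ∧
    Module.finrank ℂ K ≤ N ∧ ‖ξ‖ = 1 ∧ ∀ x, σ x = inner ℂ ξ (π x ξ)

section
variable {K : Type u} [NormedAddCommGroup K] [InnerProductSpace ℂ K] [CompleteSpace K]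

lemma IsRep.adj {π : B →L[ℂ] (K →L[ℂ] K)} (hπ : IsRep π) (x : B) (ξ η : K) :
    inner ℂ (π x ξ) η = inner ℂ ξ (π (Star.star x) η) := by
  rw [hπ.star, ContinuousLinearMap.star_eq_adjoint, ContinuousLinearMap.adjoint_inner_right]

lemma IsRep.star_mul {π : B →L[ℂ] (K →L[ℂ] K)} (hπ : IsRep π) (x : B) (ξ : K) :
    inner ℂ ξ (π (Star.star x * x) ξ) = ((‖π x ξ‖ ^ 2 : ℝ) : ℂ) := by
  rw [hπ.mul, ContinuousLinearMap.mul_apply, ← hπ.adj, inner_self_eq_norm_sq_to_K]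
  simp

/-- vector functional -/
def vecF (π : B →L[ℂ] (K →L[ℂ] K)) (ξ : K) : B →L[ℂ] ℂ :=
  (innerSL ℂ ξ).comp ((ContinuousLinearMap.apply ℂ K ξ).comp π)

lemma vecF_apply (π : B →L[ℂ] (K →L[ℂ] K)) (ξ : K) (x : B) :
    vecF π ξ x = inner ℂ ξ (π x ξ) := rfl

lemma vecF_pos {π : B →L[ℂ] (K →L[ℂ] K)} (hπ : IsRep π) (ξ : K) :
    IsPositiveFunctional (vecF π ξ) := by
  intro a
  rw [vecF_apply, hπ.star_mul]
  exact Complex.zero_le_real.mpr (by positivity)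

lemma vecF_one {π : B →L[ℂ] (K →L[ℂ] K)} (hπ : IsRep π) (ξ : K) :
    vecF π ξ 1 = ((‖ξ‖ ^ 2 : ℝ) : ℂ) := by
  rw [vecF_apply, hπ.one, ContinuousLinearMap.one_apply, inner_self_eq_norm_sq_to_K]
  simp

lemma hs_bound {ι : Type*} [Fintype ι] (e : OrthonormalBasis ι ℂ K) (T : K →L[ℂ] K) (v : K) :
    ‖T v‖ ^ 2 ≤ ‖v‖ ^ 2 * ∑ i, ‖T (e i)‖ ^ 2 := by
  have h1 : T v = ∑ i, (inner ℂ (e i) v : ℂ) • T (e i) := by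
    conv_lhs => rw [← e.sum_repr' v]
    rw [map_sum]
    simp
  have h2 : ‖T v‖ ≤ ∑ i, ‖(inner ℂ (e i) v : ℂ)‖ * ‖T (e i)‖ := by
    rw [h1]
    refine (norm_sum_le _ _).trans (Finset.sum_le_sum fun i _ => ?_)
    rw [norm_smul]
  calc ‖T v‖ ^ 2 ≤ (∑ i, ‖(inner ℂ (e i) v : ℂ)‖ * ‖T (e i)‖) ^ 2 := by gcongr
    _ ≤ (∑ i, ‖(inner ℂ (e i) v : ℂ)‖ ^ 2) * ∑ i, ‖T (e i)‖ ^ 2 :=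
      Finset.sum_mul_sq_le_sq_mul_sq _ _ _
    _ = _ := by rw [e.sum_sq_norm_inner_right]
end

lemma VS_GN {N : ℕ} {σ : B →L[ℂ] ℂ} (h : VS N σ) : GN N σ := by
  obtain ⟨K, _, _, _, π, ξ, hπ, hfd, hN, hξ, hσ⟩ := h
  have hσ' : σ = vecF π ξ := by ext x; rw [hσ, vecF_apply]
  have hξ0 : ξ ≠ 0 := by rintro rfl; simp at hξ
  haveI : Nontrivial K := ⟨⟨ξ, 0, hξ0⟩⟩
  refine ⟨⟨hσ' ▸ vecF_pos hπ ξ, by rw [hσ', vecF_one hπ, hξ]; simp⟩, ?_⟩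
  let e := stdOrthonormalBasis ℂ K
  let d := Module.finrank ℂ K
  have hd : 0 < d := Module.finrank_pos
  have hd' : (d : ℝ) ≠ 0 := by positivity
  let t : B →L[ℂ] ℂ := ((d : ℝ)⁻¹ : ℝ) • ∑ i, vecF π (e i)
  have htx : ∀ x, t x = ((d : ℝ)⁻¹ : ℝ) • ∑ i, vecF π (e i) x := by
    intro x; simp [t, ContinuousLinearMap.sum_apply]
  have htr : ∀ x, ∑ i, vecF π (e i) x = LinearMap.trace ℂ K (π x : K →ₗ[ℂ] K) := by
    intro x
    rw [LinearMap.trace_eq_sum_inner _ e]; rfl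
  have hts : ∀ x, (t (star x * x)).re = (d : ℝ)⁻¹ * ∑ i, ‖π x (e i)‖ ^ 2 := by
    intro x
    rw [htx]
    simp only [vecF_apply, hπ.star_mul, Complex.smul_re, Complex.re_sum, Complex.ofReal_re,
      smul_eq_mul]
  refine ⟨t, ⟨⟨fun x => ?_, ?_⟩, fun x y => ?_⟩, fun φ hφ x => ?_⟩
  · rw [htx]
    exact smul_nonneg (by positivity) (Finset.sum_nonneg fun i _ => vecF_pos hπ _ x)
  · rw [htx]
    simp only [vecF_one hπ, e.norm_eq_one]
    have hdc : (d : ℂ) ≠ 0 := by exact_mod_cast hd.ne'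
    simp only [one_pow, Complex.ofReal_one, Finset.sum_const, Finset.card_univ, Fintype.card_fin, nsmul_eq_mul, mul_one, Complex.real_smul, Complex.ofReal_inv, Complex.ofReal_natCast]
    exact inv_mul_cancel₀ hdc
  · rw [htx, htx, htr, htr, hπ.mul, hπ.mul]
    congr 1
    exact LinearMap.trace_mul_comm _ _ _
  · obtain ⟨n, a, ha, hφ⟩ := hφ
    have h1 : (σ (φ (star x * x))).re = ∑ i, ‖π x (π (a i) ξ)‖ ^ 2 := by
      rw [hφ, map_sum, Complex.re_sum]
      refine Finset.sum_congr rfl fun i _ => ?_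
      rw [hσ', vecF_apply, show star (a i) * (star x * x) * a i = star (x * a i) * (x * a i) by
        rw [star_mul]; noncomm_ring, hπ.star_mul, hπ.mul, Complex.ofReal_re]
      rfl
    have h2 : ∑ i, ‖π (a i) ξ‖ ^ 2 = 1 := by
      have : σ 1 = 1 := by rw [hσ', vecF_one hπ, hξ]; simp
      rw [← ha, map_sum] at this
      have := congrArg Complex.re this
      rw [Complex.re_sum] at this
      rw [Complex.one_re] at this
      rw [← this]
      refine Finset.sum_congr rfl fun i _ => ?_
      rw [hσ', vecF_apply, hπ.star_mul, Complex.ofReal_re]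
    rw [h1, hts]
    set S := ∑ i, ‖π x (e i)‖ ^ 2
    have hS : 0 ≤ S := Finset.sum_nonneg fun i _ => sq_nonneg _
    calc ∑ i, ‖π x (π (a i) ξ)‖ ^ 2 ≤ ∑ i, ‖π (a i) ξ‖ ^ 2 * S :=
          Finset.sum_le_sum fun i _ => hs_bound e _ _
      _ = S := by rw [← Finset.sum_mul, h2, one_mul]
      _ = d * ((d : ℝ)⁻¹ * S) := by field_simp
      _ ≤ N * ((d : ℝ)⁻¹ * S) := by
        gcongr

/-- pure states -/
def IsPure (σ : B →L[ℂ] ℂ) : Prop :=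
  IsState σ ∧ ∀ σ₁ σ₂ : B →L[ℂ] ℂ, IsState σ₁ → IsState σ₂ → ∀ a b : ℝ, 0 < a → 0 < b → a + b = 1 →
    a • σ₁ + b • σ₂ = σ → σ₁ = σ

section
variable {K : Type u} [NormedAddCommGroup K] [InnerProductSpace ℂ K] [CompleteSpace K]

/-- the orbit of a vector -/
def orbit (π : B →L[ℂ] (K →L[ℂ] K)) (ξ : K) : Submodule ℂ K :=
  LinearMap.range ((ContinuousLinearMap.apply ℂ K ξ).comp π : B →ₗ[ℂ] K)

lemma mem_orbit {π : B →L[ℂ] (K →L[ℂ] K)} {ξ η : K} : η ∈ orbit π ξ ↔ ∃ a, π a ξ = η := Iff.rfl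

lemma orbit_inv {π : B →L[ℂ] (K →L[ℂ] K)} (hπ : IsRep π) (ξ : K) {η : K}
    (hη : η ∈ (orbit π ξ).topologicalClosure) (x : B) :
    π x η ∈ (orbit π ξ).topologicalClosure := by
  have : (orbit π ξ).topologicalClosure ≤
      ((orbit π ξ).topologicalClosure).comap (π x : K →ₗ[ℂ] K) := by
    refine Submodule.topologicalClosure_minimal _ ?_ ?_
    · rintro _ ⟨a, rfl⟩
      refine Submodule.le_topologicalClosure _ ⟨x * a, ?_⟩
      change π (x * a) ξ = π x (π a ξ)
      rw [hπ.mul]; rfl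
    · exact (Submodule.isClosed_topologicalClosure _).preimage (π x).continuous
  exact this hη

lemma irred_of_pure {π : B →L[ℂ] (K →L[ℂ] K)} (hπ : IsRep π) (Ω : K)
    (hΩ : (orbit π Ω).topologicalClosure = ⊤) (hp : IsPure (vecF π Ω)) (ξ : K) (hξ : ξ ≠ 0) :
    (orbit π ξ).topologicalClosure = ⊤ := by
  set M := (orbit π ξ).topologicalClosure with hM
  have hcl : IsClosed (M : Set K) := Submodule.isClosed_topologicalClosure _
  haveI : CompleteSpace M := hcl.completeSpace_coe
  have key : Ω ∈ M → M = ⊤ := by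
    intro h
    rw [eq_top_iff, ← hΩ]
    refine Submodule.topologicalClosure_minimal _ ?_ hcl
    rintro _ ⟨a, rfl⟩
    exact orbit_inv hπ ξ h a
  have hξM : ξ ∈ M := Submodule.le_topologicalClosure _ ⟨1, by
    change π 1 ξ = ξ
    rw [hπ.one]; rfl⟩
  obtain ⟨Ω₁, h1, Ω₂, h2, hsum⟩ := M.exists_add_mem_mem_orthogonal Ω
  have hperp : ∀ x, ∀ m ∈ M, inner ℂ m (π x Ω₂) = 0 := by
    intro x m hm
    have := hπ.adj (star x) m Ω₂
    rw [star_star] at this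
    rw [← this]
    exact h2 _ (orbit_inv hπ ξ hm _)
  have hperp' : ∀ x, ∀ m ∈ M, inner ℂ Ω₂ (π x m) = 0 := by
    intro x m hm
    exact Submodule.inner_left_of_mem_orthogonal (orbit_inv hπ ξ hm x) h2
  have hdec : ∀ x, vecF π Ω x = vecF π Ω₁ x + vecF π Ω₂ x := by
    intro x
    simp only [vecF_apply]
    rw [hsum, map_add, inner_add_left, inner_add_right, inner_add_right, hperp x _ h1,
      hperp' x _ h1]
    ring
  by_cases hz2 : Ω₂ = 0
  · apply key
    rw [hsum, hz2, add_zero]; exact h1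
  by_cases hz1 : Ω₁ = 0
  · exfalso
    have : ∀ x, inner ℂ ξ (π x Ω) = 0 := by
      intro x
      rw [hsum, hz1, zero_add]
      exact hperp x ξ hξM
    have h3 : (orbit π Ω).topologicalClosure ≤ LinearMap.ker (innerSL ℂ ξ : K →ₗ[ℂ] ℂ) := by
      refine Submodule.topologicalClosure_minimal _ ?_ (innerSL ℂ ξ).isClosed_ker
      rintro _ ⟨a, rfl⟩
      exact this a
    rw [hΩ] at h3
    have h4 : inner ℂ ξ ξ = 0 := h3 (Submodule.mem_top (x := ξ))
    exact hξ (inner_self_eq_zero.mp h4)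
  have hl1 : 0 < ‖Ω₁‖ ^ 2 := by positivity
  have hl2 : 0 < ‖Ω₂‖ ^ 2 := by positivity
  have hl : ‖Ω₁‖ ^ 2 + ‖Ω₂‖ ^ 2 = 1 := by
    have := hdec 1
    rw [hp.1.2, vecF_one hπ, vecF_one hπ] at this
    exact_mod_cast this.symm
  have hst : ∀ v : K, 0 < ‖v‖ ^ 2 → IsState ((‖v‖ ^ 2)⁻¹ • vecF π v) := by
    intro v hv
    refine ⟨fun x => ?_, ?_⟩
    · rw [_root_.smul_apply]
      exact smul_nonneg (by positivity) (vecF_pos hπ _ x)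
    · rw [_root_.smul_apply, vecF_one hπ, ← Complex.coe_smul, smul_eq_mul, ← Complex.ofReal_mul,
        inv_mul_cancel₀ hv.ne', Complex.ofReal_one]
  have heq := hp.2 _ _ (hst _ hl1) (hst _ hl2) _ _ hl1 hl2 hl (by
    rw [smul_smul, smul_smul, mul_inv_cancel₀ hl1.ne', mul_inv_cancel₀ hl2.ne', one_smul, one_smul]
    ext x
    rw [hdec]; rfl)
  have hz : ∀ x, inner ℂ (Ω₁ - ((‖Ω₁‖ ^ 2 : ℝ) : ℂ) • Ω) (π x Ω) = 0 := by
    intro x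
    have h3 : vecF π Ω₁ x = ((‖Ω₁‖ ^ 2 : ℝ) : ℂ) * vecF π Ω x := by
      rw [← heq, _root_.smul_apply, ← Complex.coe_smul, smul_eq_mul, ← mul_assoc,
        ← Complex.ofReal_mul, mul_inv_cancel₀ hl1.ne', Complex.ofReal_one, one_mul]
    have h4 : inner ℂ Ω₁ (π x Ω) = vecF π Ω₁ x := by
      rw [hsum, map_add, inner_add_right, hperp x _ h1, add_zero]; rfl
    rw [inner_sub_left, inner_smul_left, h4, h3, Complex.conj_ofReal, vecF_apply, sub_self]
  set v := Ω₁ - ((‖Ω₁‖ ^ 2 : ℝ) : ℂ) • Ω with hv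
  have h3 : (orbit π Ω).topologicalClosure ≤ LinearMap.ker (innerSL ℂ v : K →ₗ[ℂ] ℂ) := by
    refine Submodule.topologicalClosure_minimal _ ?_ (innerSL ℂ v).isClosed_ker
    rintro _ ⟨a, rfl⟩
    exact hz a
  rw [hΩ] at h3
  have h4 : inner ℂ v v = 0 := h3 (Submodule.mem_top (x := v))
  have h5 : Ω₁ = ((‖Ω₁‖ ^ 2 : ℝ) : ℂ) • Ω := sub_eq_zero.mp (inner_self_eq_zero.mp h4)
  apply key
  have h6 : Ω = (((‖Ω₁‖ ^ 2 : ℝ) : ℂ))⁻¹ • Ω₁ := by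
    rw [eq_inv_smul_iff₀ (by exact_mod_cast hl1.ne')]
    exact h5.symm
  rw [h6]
  exact M.smul_mem _ h1
end

lemma pure_VS
    (hlim : ∀ (K : Type u) [NormedAddCommGroup K] [InnerProductSpace ℂ K]
      [CompleteSpace K] [Nontrivial K] (π : B →L[ℂ] (K →L[ℂ] K)),
      (∀ x y : B, π (x * y) = π x * π y) → (∀ x : B, π (star x) = star (π x)) →
      π 1 = 1 → (∀ ξ : K, ξ ≠ 0 → Dense {η : K | ∃ a : B, η = π a ξ}) →
      ∀ a : B, IsCompactOperator (π a))
    {σ : B →L[ℂ] ℂ} (hσ : IsPure σ) : ∃ N, VS N σ := by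
  let f := toPLM σ hσ.1.1
  let π : B →L[ℂ] (f.GNS →L[ℂ] f.GNS) :=
    LinearMap.mkContinuous (f.gnsStarAlgHom : B →ₗ[ℂ] (f.GNS →L[ℂ] f.GNS)) 1 fun x => by
      rw [one_mul]
      exact NonUnitalStarAlgHom.norm_apply_le f.gnsNonUnitalStarAlgHom x
  have hπa : ∀ x (b : f.PreGNS), π x (b : f.GNS) = (f.leftMulMapPreGNS x b : f.GNS) := fun x b =>
    f.gnsNonUnitalStarAlgHom_apply_coe
  have hπ : IsRep π := ⟨fun x y => map_mul f.gnsStarAlgHom x y, fun x => map_star f.gnsStarAlgHom x,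
    map_one f.gnsStarAlgHom⟩
  let Ω : f.GNS := (f.toPreGNS 1 : f.PreGNS)
  have hπΩ : ∀ x, π x Ω = (f.toPreGNS x : f.PreGNS) := by
    intro x
    rw [hπa]
    simp
  have hΩ : (orbit π Ω).topologicalClosure = ⊤ := by
    rw [← Submodule.dense_iff_topologicalClosure_eq_top]
    refine (UniformSpace.Completion.denseRange_coe (α := f.PreGNS)).mono ?_
    rintro _ ⟨b, rfl⟩
    exact ⟨f.ofPreGNS b, hπΩ _⟩
  have hvec : vecF π Ω = σ := by
    ext x
    rw [vecF_apply, hπΩ, UniformSpace.Completion.inner_coe, PositiveLinearMap.preGNS_inner_def]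
    simp [f, toPLM_apply]
  have hΩn : ‖Ω‖ = 1 := by
    have h1 := vecF_one hπ Ω
    rw [hvec, hσ.1.2] at h1
    have h2 : ‖Ω‖ ^ 2 = 1 := by exact_mod_cast h1.symm
    exact (pow_eq_one_iff_of_nonneg (norm_nonneg _) two_ne_zero).mp h2
  haveI : Nontrivial f.GNS := ⟨⟨Ω, 0, by intro h; rw [h] at hΩn; simp at hΩn⟩⟩
  have hirr : ∀ ξ : f.GNS, ξ ≠ 0 → Dense {η : f.GNS | ∃ a : B, η = π a ξ} := by
    intro ξ hξ
    have h1 := irred_of_pure hπ Ω hΩ (hvec.symm ▸ hσ) ξ hξ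
    rw [← Submodule.dense_iff_topologicalClosure_eq_top] at h1
    convert h1 using 1
    ext η
    exact ⟨fun ⟨a, ha⟩ => ⟨a, ha.symm⟩, fun ⟨a, ha⟩ => ⟨a, ha.symm⟩⟩
  have hc := hlim f.GNS π hπ.mul hπ.star hπ.one hirr 1
  rw [hπ.one] at hc
  have hlc : LocallyCompactSpace f.GNS := isCompactOperator_id_iff_locallyCompactSpace.mp hc
  have hfd : FiniteDimensional ℂ f.GNS := FiniteDimensional.of_locallyCompactSpace ℂ
  exact ⟨Module.finrank ℂ f.GNS, f.GNS, inferInstance, inferInstance, inferInstance, π, Ω, hπ, hfd,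
    le_rfl, hΩn, fun x => by rw [← hvec]; rfl⟩

end reps

end MaxMix

namespace MaxMix

open Filter Topology

section simons

/-- a version of the Simons inequality -/
lemma simons {E : Type*} [NormedAddCommGroup E] [NormedSpace ℝ E] [CompleteSpace E]
    (C : ℕ → Set E) (hanti : ∀ n, C (n + 1) ⊆ C n) (hconv : ∀ n, Convex ℝ (C n))
    (hcl : ∀ n, IsClosed (C n)) (hne : ∀ n, (C n).Nonempty) (h1 : ∀ n, ∀ y ∈ C n, ‖y‖ ≤ 1)
    {η : ℝ} (hη : 0 < η) (hlow : ∀ y ∈ C 0, η ≤ ‖y‖) :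
    ∃ (a : E) (z : ℕ → E), a ∈ C 0 ∧
      ∀ n, ‖z n‖ < ‖a‖ ∧ ∃ r ∈ C n, ∃ s : ℝ, a = z n + s • r := by
  have hch : ∀ (n : ℕ) (z : E), ∃ y ∈ C n, ∀ y' ∈ C n,
      ‖z + ((1 / 2 : ℝ) ^ n) • y‖ ≤ ‖z + ((1 / 2 : ℝ) ^ n) • y'‖ + η / 4 * ((1 / 2 : ℝ) ^ n) ^ 2 := by
    intro n z
    let f : E → ℝ := fun y => ‖z + ((1 / 2 : ℝ) ^ n) • y‖
    have hb : BddBelow (f '' C n) := ⟨0, by rintro _ ⟨y, -, rfl⟩; exact norm_nonneg _⟩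
    have hpos : 0 < η / 4 * ((1 / 2 : ℝ) ^ n) ^ 2 := by positivity
    obtain ⟨_, ⟨y, hy, rfl⟩, hlt⟩ := exists_lt_of_csInf_lt ((hne n).image f)
      (lt_add_of_pos_right (sInf (f '' C n)) hpos)
    refine ⟨y, hy, fun y' hy' => ?_⟩
    have := csInf_le hb ⟨y', hy', rfl⟩
    change f y ≤ f y' + _
    linarith
  choose g hgC hg using hch
  let z : ℕ → E := fun n => Nat.rec 0 (fun n z => z + ((1 / 2 : ℝ) ^ (n + 1)) • g n z) n
  have hz0 : z 0 = 0 := rfl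
  have hzs : ∀ n, z (n + 1) = z n + ((1 / 2 : ℝ) ^ (n + 1)) • g n (z n) := fun n => rfl
  obtain ⟨a, ha⟩ : ∃ a, Tendsto z atTop (𝓝 a) := by
    refine cauchySeq_tendsto_of_complete (cauchySeq_of_le_geometric (1 / 2 : ℝ) 1 (by norm_num) ?_)
    intro n
    rw [dist_comm, dist_eq_norm, hzs, add_sub_cancel_left, norm_smul, Real.norm_of_nonneg (by positivity)]
    have := h1 n _ (hgC n (z n))
    have h2 : (1 / 2 : ℝ) ^ (n + 1) ≤ (1 / 2 : ℝ) ^ n :=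
      pow_le_pow_of_le_one (by norm_num) (by norm_num) (Nat.le_succ n)
    have h3 : (0 : ℝ) < (1 / 2 : ℝ) ^ (n + 1) := by positivity
    nlinarith [norm_nonneg (g n (z n))]
  have hC' : ∀ n k, C (n + k) ⊆ C n := by
    intro n k
    induction k with
    | zero => exact subset_rfl
    | succ k ih => exact (hanti _).trans ih
  have hind : ∀ n k, ∀ y ∈ C (n + k), ∃ r ∈ C n,
      z (n + k) + ((1 / 2 : ℝ) ^ (n + k)) • y = z n + ((1 / 2 : ℝ) ^ n) • r := by
    intro n k
    induction k with
    | zero => exact fun y hy => ⟨y, hy, rfl⟩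
    | succ k ih =>
      intro y hy
      have hm := hconv (n + k) (hgC (n + k) (z (n + k))) (hanti _ hy) (a := 1 / 2) (b := 1 / 2)
        (by norm_num) (by norm_num) (by norm_num)
      obtain ⟨r, hr, h⟩ := ih _ hm
      refine ⟨r, hr, ?_⟩
      rw [← h, ← add_assoc, hzs, pow_succ, smul_add, smul_smul, smul_smul, add_assoc]
  have hr : ∀ n, ∃ r ∈ C n, a = z n + ((1 / 2 : ℝ) ^ n) • r := by
    intro n
    have hq : ((1 / 2 : ℝ) ^ n) ≠ 0 := by positivity
    refine ⟨((1 / 2 : ℝ) ^ n)⁻¹ • (a - z n), ?_, by rw [smul_inv_smul₀ hq, add_sub_cancel]⟩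
    have hl1 : Tendsto (fun k => z (n + k)) atTop (𝓝 a) := by
      refine ha.comp ?_
      exact tendsto_atTop_mono (fun k => Nat.le_add_left k n) tendsto_id
    have hl2 : Tendsto (fun k => ((1 / 2 : ℝ) ^ (n + k)) • g (n + k) (z (n + k))) atTop (𝓝 0) := by
      refine squeeze_zero_norm (a := fun k => (1 / 2 : ℝ) ^ (n + k)) (fun k => ?_) ?_
      · rw [norm_smul, Real.norm_of_nonneg (by positivity)]
        exact mul_le_of_le_one_right (by positivity) (h1 _ _ (hgC _ _))
      · exact (tendsto_pow_atTop_nhds_zero_of_lt_one (by norm_num) (by norm_num)).comp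
          (tendsto_atTop_mono (fun k => Nat.le_add_left k n) tendsto_id)
    have hl3 := ((hl1.add hl2).sub_const (z n)).const_smul ((1 / 2 : ℝ) ^ n)⁻¹
    rw [add_zero] at hl3
    refine (hcl n).mem_of_tendsto hl3 (Eventually.of_forall fun k => ?_)
    obtain ⟨r, hr, h⟩ := hind n k _ (hgC (n + k) (z (n + k)))
    rw [h, add_sub_cancel_left, inv_smul_smul₀ hq]
    exact hr
  have ha0 : a ∈ C 0 := by
    obtain ⟨r, hr, h⟩ := hr 0
    rw [hz0, pow_zero, one_smul, zero_add] at h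
    rwa [h]
  have hD : ∀ n, η / 2 * ((1 / 2 : ℝ) ^ n + ((1 / 2 : ℝ) ^ n) ^ 2) ≤ ‖a‖ - ‖z n‖ := by
    intro n
    induction n with
    | zero =>
      rw [hz0]
      have := hlow a ha0
      simp only [pow_zero, norm_zero]
      linarith
    | succ n ih =>
      obtain ⟨r, hr, h⟩ := hr n
      have h2 := hg n (z n) r hr
      rw [← h] at h2
      have h3 : z (n + 1) = (1 / 2 : ℝ) • z n + (1 / 2 : ℝ) • (z n + ((1 / 2 : ℝ) ^ n) • g n (z n)) := by
        rw [hzs, pow_succ]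
        module
      have h4 : ‖z (n + 1)‖ ≤ 1 / 2 * ‖z n‖ + 1 / 2 * ‖z n + ((1 / 2 : ℝ) ^ n) • g n (z n)‖ := by
        rw [h3]
        refine (norm_add_le _ _).trans ?_
        rw [norm_smul, norm_smul, Real.norm_of_nonneg (by norm_num)]
      rw [pow_succ]
      nlinarith
  refine ⟨a, z, ha0, fun n => ⟨?_, ?_⟩⟩
  · have := hD n
    have h5 : 0 < η / 2 * ((1 / 2 : ℝ) ^ n + ((1 / 2 : ℝ) ^ n) ^ 2) := by positivity
    linarith
  · obtain ⟨r, hr, h⟩ := hr n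
    exact ⟨r, hr, _, h⟩

end simons

section states

variable {B : Type u} [CStarAlgebra B] [PartialOrder B] [StarOrderedRing B]

lemma state_real {σ : B →L[ℂ] ℂ} (hσ : IsState σ) (x : B) : σ (star x) = star (σ x) :=
  map_star (toPLM σ hσ.1) x

lemma state_nonneg {σ : B →L[ℂ] ℂ} (hσ : IsState σ) {x : B} (hx : 0 ≤ x) : 0 ≤ σ x := by
  obtain ⟨b, rfl⟩ := CStarAlgebra.nonneg_iff_eq_star_mul_self.mp hx
  exact hσ.1 b

/-- unital contractive functionals are states -/
lemma state_of_contr {g : B →L[ℂ] ℂ} (h1 : g 1 = 1) (hg : ∀ x, ‖g x‖ ≤ ‖x‖) : IsState g := by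
  haveI : Nontrivial B := ⟨⟨1, 0, by intro h; rw [h] at h1; simp at h1⟩⟩
  refine ⟨fun b => ?_, h1⟩
  set x := star b * b with hx
  have hx0 : 0 ≤ x := star_mul_self_nonneg b
  have hxs : IsSelfAdjoint x := hx0.isSelfAdjoint
  have him : (g x).im = 0 := by
    have key : ∀ t : ℝ, ((g x).im + t) ^ 2 ≤ ‖x‖ ^ 2 + t ^ 2 := by
      intro t
      have e1 : g (x + (Complex.I * t) • (1 : B)) = g x + Complex.I * t := by
        rw [map_add, map_smul, h1]; simp
      have e2 := hg (x + (Complex.I * t) • (1 : B))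
      rw [e1] at e2
      have e3 : ‖x + (Complex.I * t) • (1 : B)‖ ^ 2 ≤ ‖x‖ ^ 2 + t ^ 2 := by
        rw [sq, ← CStarRing.norm_star_mul_self]
        have e4 : star (x + (Complex.I * t) • (1 : B)) * (x + (Complex.I * t) • (1 : B)) =
            x * x + ((t ^ 2 : ℝ) : ℂ) • (1 : B) := by
          rw [star_add, star_smul, hxs.star_eq, star_one]
          have hst : star (Complex.I * (t : ℂ)) = - (Complex.I * t) := by
            simp [mul_comm]
          have e5 : (Complex.I * (t : ℂ)) * -(Complex.I * t) = ((t ^ 2 : ℝ) : ℂ) := by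
            push_cast
            linear_combination (-(t : ℂ) ^ 2) * Complex.I_mul_I
          rw [hst]
          simp only [add_mul, mul_add, smul_mul_assoc, mul_smul_comm, one_mul, mul_one, smul_add,
            smul_smul, e5]
          rw [neg_smul]
          abel
        rw [e4]
        refine (norm_add_le _ _).trans ?_
        rw [norm_smul, Complex.norm_real, Real.norm_of_nonneg (sq_nonneg t), norm_one, mul_one]
        gcongr
        rw [sq]; exact norm_mul_le _ _
      have e6 : (g x).im + t = (g x + Complex.I * t).im := by simp
      rw [e6]
      have e7 := Complex.abs_im_le_norm (g x + Complex.I * t)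
      have e8 : (g x + Complex.I * t).im ^ 2 ≤ ‖g x + Complex.I * t‖ ^ 2 := by
        rw [← sq_abs]; gcongr
      have e9 : ‖g x + Complex.I * t‖ ^ 2 ≤ ‖x + (Complex.I * t) • (1 : B)‖ ^ 2 := by gcongr
      linarith
    by_contra hne
    have := key ((‖x‖ ^ 2 + 1) / (2 * (g x).im))
    have e : 2 * (g x).im * ((‖x‖ ^ 2 + 1) / (2 * (g x).im)) = ‖x‖ ^ 2 + 1 := by
      field_simp
    nlinarith [sq_nonneg (g x).im]
  have hre : 0 ≤ (g x).re := by
    have e1 := hg (algebraMap ℝ B ‖x‖ - x)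
    have e2 : ‖algebraMap ℝ B ‖x‖ - x‖ ≤ ‖x‖ := by
      refine (CStarAlgebra.norm_le_iff_le_algebraMap _ (norm_nonneg _) ?_).2 ?_
      · rw [sub_nonneg]
        exact (CStarAlgebra.norm_le_iff_le_algebraMap x (norm_nonneg _) hx0).1 le_rfl
      · exact sub_le_self _ hx0
    have e3 : g (algebraMap ℝ B ‖x‖ - x) = ‖x‖ - g x := by
      rw [map_sub, Algebra.algebraMap_eq_smul_one, ← Complex.coe_smul, map_smul, h1]
      simp
    rw [e3] at e1
    have e4 := Complex.re_le_norm ((‖x‖ : ℂ) - g x)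
    simp only [Complex.sub_re, Complex.ofReal_re] at e4
    linarith
  rw [Complex.nonneg_iff]
  exact ⟨hre, him.symm⟩

lemma exists_norming [Nontrivial B] {a : B} (ha : 0 ≤ a) : ∃ σ : B →L[ℂ] ℂ, IsState σ ∧ (σ a).re = ‖a‖ := by
  have hr1 : 1 ≤ ‖1 + a‖ := by
    have := CStarAlgebra.norm_le_norm_of_nonneg_of_le (a := (1 : B)) (b := 1 + a) zero_le_one
      (le_add_of_nonneg_right ha)
    rwa [norm_one] at this
  have h2 : ‖a‖ ≤ ‖1 + a‖ - 1 := by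
    rw [CStarAlgebra.norm_le_iff_le_algebraMap a (by linarith) ha, map_sub, map_one, le_sub_iff_add_le']
    exact (CStarAlgebra.norm_le_iff_le_algebraMap _ (norm_nonneg _) (add_nonneg zero_le_one ha)).1 le_rfl
  obtain ⟨g, hg1, hg⟩ := exists_dual_vector'' ℂ (1 + a)
  have hgb : ∀ x, ‖g x‖ ≤ ‖x‖ := fun x => by
    simpa using g.le_of_opNorm_le hg1 x
  rw [map_add] at hg
  have hre := congrArg Complex.re hg
  simp only [Complex.add_re] at hre
  have hre' : (g 1).re + (g a).re = ‖1 + a‖ := hre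
  have b1 := hgb 1
  rw [norm_one] at b1
  have b2 := hgb a
  have c1 := Complex.re_le_norm (g 1)
  have c2 := Complex.re_le_norm (g a)
  have d1 : (g 1).re = 1 := by linarith
  have d2 : (g a).re = ‖a‖ := by linarith
  have d3 : g 1 = 1 := by
    have e1 : ‖g 1‖ = (g 1).re := by linarith
    have e2 : (g 1).re ^ 2 + (g 1).im ^ 2 = 1 := by
      have := Complex.sq_norm (g 1)
      rw [Complex.normSq_apply, e1, d1] at this
      nlinarith
    have e3 : (g 1).im = 0 := by
      rw [d1] at e2
      have : (g 1).im ^ 2 = 0 := by linarith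
      exact pow_eq_zero_iff two_ne_zero |>.mp this
    exact Complex.ext d1 e3
  exact ⟨g, state_of_contr d3 hgb, d2⟩

lemma exists_pure_norming [Nontrivial B] {a : B} (ha : 0 ≤ a) :
    ∃ σ : B →L[ℂ] ℂ, IsPure σ ∧ (σ a).re = ‖a‖ := by
  let P : (B →L[ℂ] ℂ) → Prop := fun σ => IsState σ ∧ (σ a).re = ‖a‖
  have hc : IsCompact (wset P) := wset_compact (fun _ h x => state_bound h.1 x) fun U g h hg => by
    refine ⟨ulim_state (h.mono fun _ h => h.1) hg, ?_⟩
    refine tendsto_nhds_unique ((Complex.continuous_re.tendsto _).comp (hg a))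
      (tendsto_const_nhds.congr' ?_)
    filter_upwards [h] with i hi using hi.2.symm
  obtain ⟨σ0, h0⟩ := exists_norming ha
  obtain ⟨b, hb, hext⟩ := hc.extremePoints_nonempty ⟨StrongDual.toWeakDual σ0, h0⟩
  have hbP : P (WeakDual.toStrongDual b) := hb
  refine ⟨WeakDual.toStrongDual b, ⟨hbP.1, fun σ₁ σ₂ h1 h2 s t hs ht hst hsum => ?_⟩, hbP.2⟩
  have e1 := (Complex.re_le_norm (σ₁ a)).trans (state_bound h1 a)
  have e2 := (Complex.re_le_norm (σ₂ a)).trans (state_bound h2 a)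
  have e3 : s * (σ₁ a).re + t * (σ₂ a).re = ‖a‖ := by
    rw [← hbP.2, ← hsum]
    simp
  have g1 := mul_nonneg hs.le (sub_nonneg.2 e1)
  have g2 := mul_nonneg ht.le (sub_nonneg.2 e2)
  have g3 : s * ‖a‖ + t * ‖a‖ = ‖a‖ := by rw [← add_mul, hst, one_mul]
  have f1 : (σ₁ a).re = ‖a‖ := by
    have : s * (‖a‖ - (σ₁ a).re) = 0 := by linarith
    linarith [(mul_eq_zero.mp this).resolve_left hs.ne']
  have f2 : (σ₂ a).re = ‖a‖ := by
    have : t * (‖a‖ - (σ₂ a).re) = 0 := by linarith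
    linarith [(mul_eq_zero.mp this).resolve_left ht.ne']
  have := hext (x₁ := StrongDual.toWeakDual σ₁) ⟨h1, f1⟩ (x₂ := StrongDual.toWeakDual σ₂) ⟨h2, f2⟩
    ⟨s, t, hs, ht, hst, hsum⟩
  exact this

end states

end MaxMix

namespace MaxMix

open Filter Topology

section approx

variable {B : Type u} [CStarAlgebra B] [PartialOrder B] [StarOrderedRing B]

lemma VS_mono {m n : ℕ} (h : m ≤ n) {σ : B →L[ℂ] ℂ} (hσ : VS m σ) : VS n σ := by
  obtain ⟨K, i1, i2, i3, π, ξ, hπ, hfd, hN, hξ, hs⟩ := hσ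
  exact ⟨K, i1, i2, i3, π, ξ, hπ, hfd, hN.trans h, hξ, hs⟩

/-- the positive part of an element below `0` on the vector states is annihilated -/
lemma kill {N : ℕ} {w : B} (hw : IsSelfAdjoint w) (h : ∀ σ, VS N σ → (σ w).re ≤ 0)
    {σ : B →L[ℂ] ℂ} (hσ : VS N σ) : σ w⁺ = 0 := by
  obtain ⟨K, i1, i2, i3, π, ξ, hπ, hfd, hN, hξ, hs⟩ := hσ
  set z := w⁺ with hz
  have hz0 : 0 ≤ z := CFC.posPart_nonneg w
  have hzs : star z = z := hz0.isSelfAdjoint.star_eq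
  have hzw : w * z = z * z := by
    conv_lhs => rw [← CFC.posPart_sub_negPart w hw, sub_mul, CFC.negPart_mul_posPart, sub_zero]
  rw [hs]
  by_cases hη : π z ξ = 0
  · rw [hη, inner_zero_right]
  exfalso
  set η := π z ξ with hηd
  have hn : ‖η‖ ≠ 0 := norm_ne_zero_iff.mpr hη
  let η' : K := ((‖η‖ : ℂ))⁻¹ • η
  have hη' : ‖η'‖ = 1 := by
    simp only [η', norm_smul, norm_inv, Complex.norm_real, norm_norm]
    exact inv_mul_cancel₀ hn
  have h1 := h (vecF π η') ⟨K, i1, i2, i3, π, η', hπ, hfd, hN, hη', fun x => rfl⟩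
  have h2 : vecF π η' w = ((‖η‖⁻¹ ^ 2 : ℝ) : ℂ) * inner ℂ η (π w η) := by
    rw [vecF_apply]
    simp only [η', map_smul, inner_smul_left, inner_smul_right]
    simp
    ring
  rw [h2, Complex.re_ofReal_mul] at h1
  have h3 : (inner ℂ η (π w η) : ℂ).re ≤ 0 := by
    by_contra hc
    push Not at hc
    have : 0 < ‖η‖⁻¹ ^ 2 := by positivity
    nlinarith
  obtain ⟨s, hss⟩ := CStarAlgebra.nonneg_iff_eq_star_mul_self.mp hz0
  have h4 : inner ℂ η (π w η) = ((‖π s η‖ ^ 2 : ℝ) : ℂ) := by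
    rw [← hπ.star_mul, ← hss, hηd]
    congr 1
    change (π w * π z) ξ = (π z * π z) ξ
    rw [← hπ.mul, ← hπ.mul, hzw]
  rw [h4, Complex.ofReal_re] at h3
  have h5 : π s η = 0 := by
    have : ‖π s η‖ ^ 2 = 0 := le_antisymm h3 (sq_nonneg _)
    exact norm_eq_zero.mp (pow_eq_zero_iff two_ne_zero |>.mp this)
  have h6 : π z η = 0 := by
    rw [hss, hπ.mul, ContinuousLinearMap.mul_apply, h5, map_zero]
  have h7 : inner ℂ η η = (0 : ℂ) := by
    conv_lhs => rw [hηd, hπ.adj, hzs, h6, inner_zero_right]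
  exact hη (inner_self_eq_zero.mp h7)

lemma exists_killed {N : ℕ} {ω : B →L[ℂ] ℂ} (hω : IsState ω) {ε : ℝ} (hε : 0 < ε) (hε1 : ε ≤ 1)
    (h : ∀ σ, GN N σ → ¬ ∀ x, ‖ω x - σ x‖ ≤ ε * ‖x‖) :
    ∃ y : B, 0 ≤ y ∧ ‖y‖ ≤ 1 ∧ ε / 2 ≤ (ω y).re ∧ ∀ σ, VS N σ → σ y = 0 := by
  haveI : Nontrivial B := ⟨⟨1, 0, by intro h1; have := hω.2; rw [h1] at this; simp at this⟩⟩
  obtain ⟨x, c, hc, hcω⟩ := separate hε h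
  by_cases hVS : ∃ σ : B →L[ℂ] ℂ, VS N σ
  swap
  · refine ⟨1, zero_le_one, norm_one.le, by rw [hω.2]; simp; linarith, fun σ hσ => (hVS ⟨σ, hσ⟩).elim⟩
  obtain ⟨σ0, hσ0⟩ := hVS
  have b0 := hc σ0 (VS_GN hσ0)
  have b1 := (Complex.abs_re_le_norm (σ0 x)).trans (state_bound (VS_GN hσ0).1 x)
  have b2 := (Complex.abs_re_le_norm (ω x)).trans (state_bound hω x)
  rw [abs_le] at b1 b2
  have hR : 0 < ‖x‖ := by
    rcases (norm_nonneg x).eq_or_lt with h0 | h0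
    · rw [← h0] at b1 b2 hcω
      linarith
    · exact h0
  have hεR : 0 < ε * ‖x‖ := by positivity
  have hcR : |c| ≤ ‖x‖ := abs_le.mpr ⟨by linarith, by linarith⟩
  let hh : B := (1 / 2 : ℂ) • (x + star x)
  have hhs : IsSelfAdjoint hh := by
    change star hh = hh
    simp only [hh, star_smul, star_add, star_star]
    rw [add_comm]
    simp
  have hhn : ‖hh‖ ≤ ‖x‖ := by
    simp only [hh, norm_smul]
    have := norm_add_le x (star x)
    rw [norm_star] at this
    norm_num
    linarith
  have hhσ : ∀ σ : B →L[ℂ] ℂ, IsState σ → (σ hh).re = (σ x).re := by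
    intro σ hσ
    simp only [hh, map_smul, map_add, state_real hσ]
    simp
    ring
  let w : B := hh - (c : ℂ) • (1 : B)
  have hws : IsSelfAdjoint w := by
    refine hhs.sub ?_
    change star _ = _
    simp
  have hwn : ‖w‖ ≤ 2 * ‖x‖ := by
    refine (norm_sub_le _ _).trans ?_
    rw [norm_smul (c : ℂ) (1 : B), Complex.norm_real, norm_one, mul_one, Real.norm_eq_abs]
    linarith
  have hwσ : ∀ σ : B →L[ℂ] ℂ, IsState σ → (σ w).re = (σ x).re - c := by
    intro σ hσ
    simp only [w, map_sub, map_smul, hσ.2, Complex.sub_re, hhσ σ hσ]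
    simp
  have hz0 : 0 ≤ w⁺ := CFC.posPart_nonneg w
  have hr0 : 0 ≤ (2 * ‖x‖)⁻¹ := by positivity
  refine ⟨((2 * ‖x‖)⁻¹ : ℝ) • w⁺, smul_nonneg hr0 hz0, ?_, ?_, fun σ hσ => ?_⟩
  · rw [norm_smul, Real.norm_of_nonneg hr0]
    have := (CStarAlgebra.norm_posPart_le w).trans hwn
    rw [inv_mul_le_iff₀ (by positivity)]
    linarith
  · have e1 : 0 ≤ ω (w⁺ - w) := state_nonneg hω (sub_nonneg.mpr (CFC.le_posPart hws))
    have e2 := (Complex.le_def.mp e1).1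
    rw [map_sub, Complex.sub_re, hwσ ω hω, Complex.zero_re] at e2
    rw [← Complex.coe_smul, map_smul, smul_eq_mul, Complex.re_ofReal_mul, le_inv_mul_iff₀ (by positivity)]
    linarith
  · rw [← Complex.coe_smul, map_smul, kill hws (fun σ hσ => ?_) hσ, smul_zero]
    rw [hwσ σ (VS_GN hσ).1]
    linarith [hc σ (VS_GN hσ)]

/-- norm approximation of states -/
lemma approx (hp : ∀ σ : B →L[ℂ] ℂ, IsPure σ → ∃ N, VS N σ) {ω : B →L[ℂ] ℂ} (hω : IsState ω)
    {ε : ℝ} (hε : 0 < ε) (hε1 : ε ≤ 1) :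
    ∃ (N : ℕ) (σ : B →L[ℂ] ℂ), GN N σ ∧ ∀ x, ‖ω x - σ x‖ ≤ ε * ‖x‖ := by
  haveI : Nontrivial B := ⟨⟨1, 0, by intro h1; have := hω.2; rw [h1] at this; simp at this⟩⟩
  by_contra hcon
  push Not at hcon
  have hk := fun N : ℕ => exists_killed (N := N) hω hε hε1 (fun σ hσ h => by
    obtain ⟨x, hx⟩ := hcon N σ hσ
    exact absurd (h x) (not_le.mpr hx))
  let C : ℕ → Set B := fun n =>
    {y | 0 ≤ y ∧ ‖y‖ ≤ 1 ∧ ε / 2 ≤ (ω y).re ∧ ∀ σ, VS n σ → σ y = 0}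
  have hcl : ∀ n, IsClosed (C n) := by
    intro n
    refine (isClosed_Ici (a := (0 : B))).inter (IsClosed.inter ?_ (IsClosed.inter ?_ ?_))
    · exact isClosed_le continuous_norm continuous_const
    · exact isClosed_le continuous_const (Complex.continuous_re.comp ω.continuous)
    · change IsClosed {y : B | ∀ σ, VS n σ → σ y = 0}
      simp only [Set.setOf_forall]
      exact isClosed_iInter fun σ => isClosed_iInter fun _ =>
        isClosed_eq σ.continuous continuous_const
  have hconv : ∀ n, Convex ℝ (C n) := by
    rintro n x ⟨x1, x2, x3, x4⟩ y ⟨y1, y2, y3, y4⟩ a b ha hb hab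
    refine ⟨add_nonneg (smul_nonneg ha x1) (smul_nonneg hb y1), ?_, ?_, fun σ hσ => ?_⟩
    · refine (norm_add_le _ _).trans ?_
      rw [norm_smul, norm_smul, Real.norm_of_nonneg ha, Real.norm_of_nonneg hb]
      nlinarith
    · rw [map_add, ← Complex.coe_smul, ← Complex.coe_smul, map_smul, map_smul, smul_eq_mul,
        smul_eq_mul, Complex.add_re, Complex.re_ofReal_mul, Complex.re_ofReal_mul]
      nlinarith
    · rw [map_add, ← Complex.coe_smul, ← Complex.coe_smul, map_smul, map_smul, x4 σ hσ, y4 σ hσ,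
        smul_zero, smul_zero, add_zero]
  obtain ⟨a, z, ha, hz⟩ := simons C
    (fun n y hy => ⟨hy.1, hy.2.1, hy.2.2.1, fun σ hσ => hy.2.2.2 σ (VS_mono n.le_succ hσ)⟩) hconv hcl hk
    (fun n y hy => hy.2.1) (half_pos hε)
    (fun y hy => hy.2.2.1.trans ((Complex.re_le_norm _).trans (state_bound hω y)))
  obtain ⟨σ, hσ, hσa⟩ := exists_pure_norming ha.1
  obtain ⟨d, hd⟩ := hp σ hσ
  obtain ⟨hlt, r, hr, s, has⟩ := hz d
  have e1 : σ a = σ (z d) := by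
    rw [has, map_add, ← Complex.coe_smul, map_smul, hr.2.2.2 σ hd, smul_zero, add_zero]
  have e2 := (Complex.re_le_norm (σ (z d))).trans (state_bound hσ.1 (z d))
  rw [← e1, hσa] at e2
  linarith

end approx

end MaxMix

namespace MaxMix

open Filter Topology

section final

variable {B : Type u} [CStarAlgebra B] [PartialOrder B] [StarOrderedRing B]

lemma ucp_id : IsElementaryUCP (ContinuousLinearMap.id ℂ B) :=
  ⟨1, fun _ => 1, by simp, fun x => by simp⟩

lemma state_comp {σ : B →L[ℂ] ℂ} (hσ : IsState σ) {φ : B →L[ℂ] B} (hφ : IsElementaryUCP φ) :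
    IsState (σ.comp φ) := by
  obtain ⟨n, a, ha, h⟩ := hφ
  refine ⟨fun x => ?_, ?_⟩
  · rw [ContinuousLinearMap.comp_apply, h, map_sum]
    refine Finset.sum_nonneg fun i _ => ?_
    rw [show star (a i) * (star x * x) * a i = star (x * a i) * (x * a i) by
        rw [star_mul]; noncomm_ring]
    exact hσ.1 _
  · rw [ContinuousLinearMap.comp_apply, h]
    simp only [mul_one]
    rw [ha, hσ.2]

/-- the main argument -/
lemma main (hp : ∀ σ : B →L[ℂ] ℂ, IsPure σ → ∃ N, VS N σ) {ω ρ : B →L[ℂ] ℂ} (hω : IsState ω)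
    (hcl : InWeakStarClosure (mixSet ω) ρ) : InWeakStarClosure (mixSet ρ) ω := by
  classical
  have hch : ∀ i : Finset B × ℕ, ∃ φ : B →L[ℂ] B, IsElementaryUCP φ ∧
      ∀ x ∈ i.1, ‖ρ x - ω (φ x)‖ < 1 / ((i.2 : ℝ) + 1) := by
    rintro ⟨F, k⟩
    obtain ⟨σ, ⟨φ, hφ, rfl⟩, h⟩ := hcl (1 / ((k : ℝ) + 1)) (by positivity) F.card
      (fun j => (F.equivFin.symm j : B))
    refine ⟨φ, hφ, fun x hx => ?_⟩
    have := h (F.equivFin ⟨x, hx⟩)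
    simpa using this
  choose φ hφ hφρ using hch
  have htend : ∀ x, Tendsto (fun i => ω (φ i x)) atTop (𝓝 (ρ x)) := by
    intro x
    rw [Metric.tendsto_atTop]
    intro ε hε
    obtain ⟨k, hk⟩ := exists_nat_one_div_lt hε
    refine ⟨({x}, k), fun i hi => ?_⟩
    rw [dist_comm, dist_eq_norm]
    refine (hφρ i x (hi.1 (Finset.mem_singleton_self x))).trans_le (le_trans ?_ hk.le)
    have : (k : ℝ) ≤ i.2 := by exact_mod_cast hi.2
    gcongr
  let U : Ultrafilter (Finset B × ℕ) := Ultrafilter.of atTop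
  have hU : (U : Filter (Finset B × ℕ)) ≤ atTop := Ultrafilter.of_le _
  intro ε₀ hε₀ n xs
  set M : ℝ := ∑ j, ‖xs j‖ with hM
  have hM0 : 0 ≤ M := Finset.sum_nonneg fun _ _ => norm_nonneg _
  have hxM : ∀ j, ‖xs j‖ ≤ M := fun j =>
    Finset.single_le_sum (f := fun j => ‖xs j‖) (fun _ _ => norm_nonneg _) (Finset.mem_univ j)
  let ε : ℝ := min 1 (ε₀ / (3 * (M + 1)))
  have hε : 0 < ε := lt_min one_pos (by positivity)
  have hε2 : 3 * ε * M < ε₀ := by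
    have h1 : ε ≤ ε₀ / (3 * (M + 1)) := min_le_right _ _
    rw [le_div_iff₀ (by positivity)] at h1
    nlinarith
  obtain ⟨N, ω', ⟨hω', t, ⟨htst, httr⟩, hdom⟩, happ⟩ := approx hp hω hε (min_le_left _ _)
  obtain ⟨ρ', hρ'⟩ := ulim U (fun i => ω'.comp (φ i)) (Eventually.of_forall fun i x =>
    state_bound (state_comp hω' (hφ i)) x)
  have hρ's : IsState ρ' := ulim_state (Eventually.of_forall fun i => state_comp hω' (hφ i)) hρ'
  have hρρ' : ∀ x, ‖ρ x - ρ' x‖ ≤ ε * ‖x‖ := by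
    intro x
    refine le_of_tendsto (((htend x).mono_left hU).sub (hρ' x)).norm (Eventually.of_forall fun i => ?_)
    refine (happ (φ i x)).trans ?_
    exact mul_le_mul_of_nonneg_left (ucp_contr (hφ i) x) hε.le
  let T := toPLM t htst.1
  have hN0 : (0 : ℝ) ≤ N := Nat.cast_nonneg N
  have hdb : ∀ f : B →L[ℂ] ℂ, IsState f → (∀ x, (f (star x * x)).re ≤ N * (t (star x * x)).re) →
      ∀ x, ‖f x‖ ≤ √(N : ℝ) * nrm T x := by
    intro f hf h x
    have := dom_bound T f hf.1 hN0 h x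
    rwa [hf.2, Complex.one_re, one_mul] at this
  obtain ⟨ψ, hψ, hψe⟩ := propB T (fun x y => httr x y) htst.2 hω'.1 hρ's.1 (Real.sqrt_nonneg (N : ℝ))
    (hdb ω' hω' fun x => hdom _ ucp_id x)
    (hdb ρ' hρ's fun x => le_of_tendsto ((Complex.continuous_re.tendsto _).comp (hρ' _))
      (Eventually.of_forall fun i => hdom (φ i) (hφ i) x))
    (fun m η hη => by
      have h1 : ∀ᶠ i in (U : Filter (Finset B × ℕ)), ‖ρ' m - ω' (φ i m)‖ < η := by
        have := (hρ' m).eventually (Metric.ball_mem_nhds _ hη)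
        filter_upwards [this] with i hi
        rw [← dist_eq_norm, dist_comm]; exact hi
      obtain ⟨i, hi⟩ := h1.exists
      have hdi := hdb _ (state_comp hω' (hφ i)) (fun x => hdom (φ i) (hφ i) x)
      obtain ⟨k, a, ha, h⟩ := hφ i
      refine ⟨k, a, ha, fun x => ?_, ?_⟩
      · have := hdi x
        rwa [ContinuousLinearMap.comp_apply, h, map_sum] at this
      · rwa [h, map_sum] at hi) hε
  refine ⟨ρ.comp ψ, ⟨ψ, hψ, rfl⟩, fun j => ?_⟩
  have e1 := happ (xs j)
  have e2 := hψe (xs j)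
  have e3 : ‖ρ (ψ (xs j)) - ρ' (ψ (xs j))‖ ≤ ε * ‖xs j‖ :=
    (hρρ' _).trans (mul_le_mul_of_nonneg_left (ucp_contr hψ _) hε.le)
  have e4 : ω (xs j) - (ρ.comp ψ) (xs j) = (ω (xs j) - ω' (xs j)) + (ω' (xs j) - ρ' (ψ (xs j))) -
      (ρ (ψ (xs j)) - ρ' (ψ (xs j))) := by
    rw [ContinuousLinearMap.comp_apply]; ring
  rw [e4]
  have e5 := norm_sub_le ((ω (xs j) - ω' (xs j)) + (ω' (xs j) - ρ' (ψ (xs j))))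
    (ρ (ψ (xs j)) - ρ' (ψ (xs j)))
  have e6 := norm_add_le (ω (xs j) - ω' (xs j)) (ω' (xs j) - ρ' (ψ (xs j)))
  have e7 := mul_le_mul_of_nonneg_left (hxM j) hε.le
  nlinarith

end final

end MaxMix


/-- **Corollary.** On a unital liminal C*-algebra (the image of `A` under every
irreducible representation consists of compact operators), every state is
maximally mixed. -/
theorem isMaximallyMixed_of_liminal
    (hlim : ∀ (K : Type u) [NormedAddCommGroup K] [InnerProductSpace ℂ K]
      [CompleteSpace K] [Nontrivial K] (π : A →L[ℂ] (K →L[ℂ] K)),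
      (∀ x y : A, π (x * y) = π x * π y) → (∀ x : A, π (star x) = star (π x)) →
      π 1 = 1 → (∀ ξ : K, ξ ≠ 0 → Dense {η : K | ∃ a : A, η = π a ξ}) →
      ∀ a : A, IsCompactOperator (π a))
    (ω : A →L[ℂ] ℂ) (hω : IsState ω) : IsMaximallyMixed ω := by

  letI : CStarAlgebra A := {}
  letI : PartialOrder A := CStarAlgebra.spectralOrder A
  haveI : StarOrderedRing A := CStarAlgebra.spectralOrderedRing A
  exact ⟨hω, fun ρ _ hcl => MaxMix.main (fun σ hσ => MaxMix.pure_VS hlim hσ) hω hcl⟩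

end
end

section
/- Let A be a unital C*-algebra having exactly one maximal closed two-sided ideal M (for instance, A simple, or A a factor). Then a state ω on A is maximally mixed if and only if ω vanishes on M. -/
universe u

open scoped ComplexConjugate ComplexOrder

noncomputable section

variable {A : Type u} [NormedRing A] [StarRing A] [CStarRing A]
  [NormedAlgebra ℂ A] [StarModule ℂ A] [CompleteSpace A]

section Helpers

variable {B : Type u} [CStarAlgebra B] [PartialOrder B] [StarOrderedRing B]

lemma state_nonneg {ω : B →L[ℂ] ℂ} (hω : IsPositiveFunctional ω) {a : B} (ha : 0 ≤ a) :
    0 ≤ ω a := by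
  obtain ⟨b, rfl⟩ := CStarAlgebra.nonneg_iff_eq_star_mul_self.mp ha
  exact hω b

lemma state_mono {ω : B →L[ℂ] ℂ} (hω : IsPositiveFunctional ω) {a b : B} (h : a ≤ b) :
    (ω a).re ≤ (ω b).re := by
  have := state_nonneg hω (sub_nonneg.2 h)
  have h2 := (Complex.nonneg_iff.1 this).1
  simp at h2
  linarith

lemma state_im {ω : B →L[ℂ] ℂ} (hω : IsPositiveFunctional ω) {a : B} (ha : IsSelfAdjoint a) :
    (ω a).im = 0 := by
  rw [← CFC.posPart_sub_negPart a ha, map_sub, Complex.sub_im]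
  have h1 := (Complex.nonneg_iff.1 (state_nonneg hω (CFC.posPart_nonneg a))).2
  have h2 := (Complex.nonneg_iff.1 (state_nonneg hω (CFC.negPart_nonneg a))).2
  rw [← h1, ← h2]; simp

lemma state_re {ω : B →L[ℂ] ℂ} (hω : IsPositiveFunctional ω) (z : B) :
    (ω z).re = (ω (realPart z : B)).re := by
  conv_lhs => rw [← realPart_add_I_smul_imaginaryPart z]
  have := state_im hω (imaginaryPart z).2
  simp [this]

lemma comp_state {ρ : B →L[ℂ] ℂ} (hρ : IsState ρ) {φ : B →L[ℂ] B} (hφ : IsElementaryUCP φ) :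
    IsState (ρ.comp φ) := by
  obtain ⟨n, a, h1, h2⟩ := hφ
  constructor
  · intro b
    apply state_nonneg hρ.1
    change 0 ≤ φ (star b * b)
    rw [h2]
    refine Finset.sum_nonneg fun i _ => ?_
    exact star_left_conjugate_nonneg (star_mul_self_nonneg b) _
  · simp [h2, h1, hρ.2]

/-- The elementary map attached to a finite family. -/
def elemMap {n : ℕ} (a : Fin n → B) : B →L[ℂ] B :=
  ∑ i, ContinuousLinearMap.mulLeftRight ℂ B (star (a i)) (a i)

lemma elemMap_apply {n : ℕ} (a : Fin n → B) (x : B) :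
    elemMap a x = ∑ i, star (a i) * x * a i := by
  simp [elemMap]

lemma elem_convex {φ ψ : B →L[ℂ] B} (hφ : IsElementaryUCP φ) (hψ : IsElementaryUCP ψ)
    {s t : ℝ} (hs : 0 ≤ s) (ht : 0 ≤ t) (hst : s + t = 1) :
    IsElementaryUCP ((s : ℂ) • φ + (t : ℂ) • ψ) := by
  obtain ⟨n, a, h1, h2⟩ := hφ
  obtain ⟨m, b, h3, h4⟩ := hψ
  have es : ((√s : ℝ) : ℂ) * ((√s : ℝ) : ℂ) = s := by
    rw [← Complex.ofReal_mul, Real.mul_self_sqrt hs]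
  have et : ((√t : ℝ) : ℂ) * ((√t : ℝ) : ℂ) = t := by
    rw [← Complex.ofReal_mul, Real.mul_self_sqrt ht]
  refine ⟨n + m, Fin.append (fun i => ((√s : ℝ) : ℂ) • a i) (fun i => ((√t : ℝ) : ℂ) • b i),
    ?_, fun x => ?_⟩
  · simp only [Fin.sum_univ_add, Fin.append_left, Fin.append_right, star_smul, smul_mul_assoc,
      mul_smul_comm, smul_smul, ← Finset.smul_sum, h1, h3, RCLike.star_def, Complex.conj_ofReal,
      es, et]
    rw [← add_smul, ← Complex.ofReal_add, hst]; simp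
  · simp only [Fin.sum_univ_add, Fin.append_left, Fin.append_right, star_smul, smul_mul_assoc,
      mul_smul_comm, smul_smul, ← Finset.smul_sum, RCLike.star_def, Complex.conj_ofReal,
      es, et]
    simp [h2, h4]

/-- Algebraic two-sided ideals. -/
def IsAlgIdeal (J : Set B) : Prop :=
  (0 : B) ∈ J ∧ (∀ x ∈ J, ∀ y ∈ J, x + y ∈ J) ∧
    (∀ (c : ℂ), ∀ x ∈ J, c • x ∈ J) ∧ (∀ (a : B), ∀ x ∈ J, a * x ∈ J ∧ x * a ∈ J)

lemma algIdeal_dist {J : Set B} (hJ : IsAlgIdeal J) (h1 : (1 : B) ∉ J) {z : B} (hz : z ∈ J) :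
    1 ≤ ‖1 - z‖ := by
  by_contra! h
  have hu : IsUnit z := by
    have := isUnit_one_sub_of_norm_lt_one h
    simpa using this
  obtain ⟨v, hv⟩ := hu.exists_left_inv
  exact h1 (hv ▸ (hJ.2.2.2 v z hz).1)

lemma algIdeal_closure {J : Set B} (hJ : IsAlgIdeal J) : IsAlgIdeal (closure J) := by
  obtain ⟨h0, ha, hs, hm⟩ := hJ
  refine ⟨subset_closure h0, fun x hx y hy => ?_, fun c x hx => ?_, fun a x hx => ⟨?_, ?_⟩⟩
  · exact map_mem_closure₂ continuous_add hx hy ha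
  · exact map_mem_closure (continuous_const_smul c) hx (hs c)
  · exact map_mem_closure (continuous_const_mul a) hx (fun x hx => (hm a x hx).1)
  · exact map_mem_closure (f := fun z => z * a) (continuous_mul_const a) hx (fun x hx => (hm a x hx).2)

lemma algIdeal_closure_one {J : Set B} (hJ : IsAlgIdeal J) (h1 : (1 : B) ∉ J) :
    (1 : B) ∉ closure J := by
  intro h
  obtain ⟨z, hz, hd⟩ := Metric.mem_closure_iff.1 h 1 one_pos
  rw [dist_eq_norm] at hd
  exact absurd (algIdeal_dist hJ h1 hz) (not_le.2 hd)

lemma algIdeal_univ {J : Set B} (hJ : IsAlgIdeal J) (h1 : (1 : B) ∈ J) : J = Set.univ := by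
  ext x
  simpa using (hJ.2.2.2 x 1 h1).1

lemma exists_maximal {I : Set B} (hI : IsAlgIdeal I) (h1 : (1 : B) ∉ I) :
    ∃ M : Set B, I ⊆ M ∧ IsMaximalIdeal M := by
  obtain ⟨M, hIM, hM⟩ := zorn_subset_nonempty {J : Set B | IsAlgIdeal J ∧ (1 : B) ∉ J} (by
    intro c hc hch hne
    refine ⟨⋃₀ c, ⟨⟨?_, ?_, ?_, ?_⟩, ?_⟩, fun s hs => Set.subset_sUnion_of_mem hs⟩
    · obtain ⟨J, hJ⟩ := hne
      exact ⟨J, hJ, (hc hJ).1.1⟩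
    · rintro x ⟨J, hJ, hx⟩ y ⟨K, hK, hy⟩
      rcases hch.total hJ hK with h | h
      · exact ⟨K, hK, (hc hK).1.2.1 x (h hx) y hy⟩
      · exact ⟨J, hJ, (hc hJ).1.2.1 x hx y (h hy)⟩
    · rintro r x ⟨J, hJ, hx⟩
      exact ⟨J, hJ, (hc hJ).1.2.2.1 r x hx⟩
    · rintro r x ⟨J, hJ, hx⟩
      exact ⟨⟨J, hJ, ((hc hJ).1.2.2.2 r x hx).1⟩, ⟨J, hJ, ((hc hJ).1.2.2.2 r x hx).2⟩⟩
    · rintro ⟨J, hJ, hx⟩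
      exact (hc hJ).2 hx) I ⟨hI, h1⟩
  have hMi := hM.prop
  have hcl : closure M = M := Set.Subset.antisymm
    (hM.le_of_ge ⟨algIdeal_closure hMi.1, algIdeal_closure_one hMi.1 hMi.2⟩ subset_closure)
    subset_closure
  refine ⟨M, hIM, ⟨hcl ▸ isClosed_closure, hMi.1⟩, fun h => hMi.2 (h ▸ Set.mem_univ _), ?_⟩
  intro N' hN' hne hMN
  exact Set.Subset.antisymm
    (hM.le_of_ge ⟨hN'.2, fun h => hne (algIdeal_univ hN'.2 h)⟩ hMN) hMN

/-- The additive span of `a f b`. -/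
def genIdeal (f : B) : AddSubmonoid B :=
  AddSubmonoid.closure {z | ∃ a b : B, z = a * f * b}

lemma genIdeal_alg (f : B) : IsAlgIdeal (genIdeal f : Set B) := by
  have key : ∀ g : B →+ B, (∀ a b, ∃ a' b', g (a * f * b) = a' * f * b') →
      ∀ x ∈ genIdeal f, g x ∈ genIdeal f := by
    intro g hg x hx
    have : genIdeal f ≤ (genIdeal f).comap g := by
      refine AddSubmonoid.closure_le.2 ?_
      rintro _ ⟨a, b, rfl⟩
      exact AddSubmonoid.subset_closure (hg a b)
    exact this hx
  refine ⟨zero_mem (genIdeal f), fun x hx y hy => add_mem (S := AddSubmonoid B) hx hy,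
    fun c x hx => ?_, fun r x hx => ⟨?_, ?_⟩⟩
  · exact key (DistribSMul.toAddMonoidHom B c) (fun a b => ⟨c • a, b, by simp⟩) x hx
  · exact key (AddMonoidHom.mulLeft r) (fun a b => ⟨r * a, b, by simp [mul_assoc]⟩) x hx
  · exact key (AddMonoidHom.mulRight r) (fun a b => ⟨a, b * r, by simp [mul_assoc]⟩) x hx

lemma genIdeal_bound {f : B} (hf : IsSelfAdjoint f) {z : B} (hz : z ∈ genIdeal f) :
    ∃ (n : ℕ) (c : Fin n → B), star z * z ≤ ∑ i, star (c i) * (f * f) * c i := by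
  induction hz using AddSubmonoid.closure_induction with
  | mem x hx =>
    obtain ⟨a, b, rfl⟩ := hx
    refine ⟨1, fun _ => ((‖a‖ : ℝ) : ℂ) • b, ?_⟩
    have h1 : star (f * b) * (star a * a) * (f * b) ≤ ‖star a * a‖ • (star (f * b) * (f * b)) :=
      CStarAlgebra.star_left_conjugate_le_norm_smul (.star_mul_self a)
    rw [CStarRing.norm_star_mul_self] at h1
    simp only [Finset.univ_unique, Finset.sum_singleton, star_smul, smul_mul_assoc,
      mul_smul_comm, smul_smul, RCLike.star_def, Complex.conj_ofReal]
    rw [← Complex.ofReal_mul, Complex.coe_smul]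
    simpa [mul_assoc, hf.star_eq] using h1
  | zero => exact ⟨0, Fin.elim0, by simp⟩
  | add x y _ _ hx hy =>
    obtain ⟨n, c, hc⟩ := hx
    obtain ⟨m, d, hd⟩ := hy
    have e2 : ((√2 : ℝ) : ℂ) * ((√2 : ℝ) : ℂ) = 2 := by
      rw [← Complex.ofReal_mul, Real.mul_self_sqrt zero_le_two]; simp
    refine ⟨n + m, Fin.append (fun i => ((√2 : ℝ) : ℂ) • c i) (fun i => ((√2 : ℝ) : ℂ) • d i), ?_⟩
    simp only [Fin.sum_univ_add, Fin.append_left, Fin.append_right, star_smul, smul_mul_assoc,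
      mul_smul_comm, smul_smul, ← Finset.smul_sum, RCLike.star_def, Complex.conj_ofReal, e2]
    have h3 : star (x + y) * (x + y) ≤ (star x * x + star x * x) + (star y * y + star y * y) := by
      rw [← sub_nonneg]
      have := star_mul_self_nonneg (x - y)
      convert this using 1
      simp only [star_add, star_sub]
      noncomm_ring
    rw [two_smul, two_smul]
    exact h3.trans (add_le_add (add_le_add hc hc) (add_le_add hd hd))

lemma key_map {N : Set B} (huniq : ∀ N' : Set B, IsMaximalIdeal N' → N' = N)
    {y : B} (hy : IsSelfAdjoint y) (hyN : y⁺ ∉ N) :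
    ∃ φ : B →L[ℂ] B, IsElementaryUCP φ ∧ 0 ≤ φ y := by
  have hf : IsSelfAdjoint (y⁺) := (CFC.posPart_nonneg y).isSelfAdjoint
  have h1 : (1 : B) ∈ genIdeal (y⁺) := by
    by_contra h
    obtain ⟨M, hM, hMm⟩ := exists_maximal (genIdeal_alg (y⁺)) h
    rw [huniq M hMm] at hM
    exact hyN (hM (AddSubmonoid.subset_closure ⟨1, 1, by simp⟩))
  obtain ⟨n, c, hc⟩ := genIdeal_bound hf h1
  set h := ∑ i, star (c i) * (y⁺ * y⁺) * c i with hh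
  rw [star_one, one_mul] at hc
  have hpos : IsStrictlyPositive h := IsStrictlyPositive.of_le isStrictlyPositive_one hc
  have hk := CFC.conjugate_rpow_neg_one_half h hpos
  set k := h ^ (-(1 / 2) : ℝ) with hkdef
  have hks : star k = k := (CFC.rpow_nonneg (a := h)).isSelfAdjoint.star_eq
  have hprod : y⁺ * y * y⁺ = star (y⁺) * y⁺ * y⁺ := by
    have h0 : y⁺ * y = y⁺ * y⁺ := by
      nth_rw 2 [← CFC.posPart_sub_negPart y hy]
      rw [mul_sub, CFC.posPart_mul_negPart, sub_zero]
    rw [h0, hf.star_eq]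
  refine ⟨elemMap (fun i => y⁺ * c i * k), ⟨n, _, ?_, elemMap_apply _⟩, ?_⟩
  · rw [← hk, hh, Finset.mul_sum, Finset.sum_mul]
    refine Finset.sum_congr rfl fun i _ => ?_
    simp [hks, hf.star_eq, mul_assoc]
  · rw [elemMap_apply]
    refine Finset.sum_nonneg fun i _ => ?_
    have : 0 ≤ star (c i * k) * (y⁺ * y * y⁺) * (c i * k) := by
      apply star_left_conjugate_nonneg
      rw [hprod]
      have h2 := star_left_conjugate_nonneg (CFC.posPart_nonneg y) (y⁺)
      exact h2
    simpa [hf.star_eq, mul_assoc] using this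

lemma mem_closure_mix {N : Set B} (huniq : ∀ N' : Set B, IsMaximalIdeal N' → N' = N)
    {ω ρ : B →L[ℂ] ℂ} (hω : IsState ω) (hρ : IsState ρ) (hωN : ∀ x ∈ N, ω x = 0) :
    InWeakStarClosure (mixSet ρ) ω := by
  intro ε hε n x
  let K : Set (Fin n → ℂ) := {v | ∃ φ : B →L[ℂ] B, IsElementaryUCP φ ∧ v = fun i => ρ (φ (x i))}
  suffices hK : (fun i => ω (x i)) ∈ closure K by
    obtain ⟨_, ⟨φ, hφ, rfl⟩, hd⟩ := Metric.mem_closure_iff.1 hK ε hε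
    refine ⟨ρ.comp φ, ⟨φ, hφ, rfl⟩, fun i => ?_⟩
    have := (dist_pi_lt_iff hε).1 hd i
    simpa [dist_eq_norm] using this
  by_contra hK
  have hconv : Convex ℝ K := by
    rintro _ ⟨φ, hφ, rfl⟩ _ ⟨ψ, hψ, rfl⟩ s t hs ht hst
    refine ⟨_, elem_convex hφ hψ hs ht hst, ?_⟩
    ext i
    simp
  obtain ⟨g, u, hg1, hg2⟩ := RCLike.geometric_hahn_banach_closed_point (𝕜 := ℂ)
    hconv.closure isClosed_closure hK
  let z : B := ∑ i, g (Pi.single i 1) • x i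
  have hgz : ∀ σ : B →L[ℂ] ℂ, g (fun i => σ (x i)) = σ z := by
    intro σ
    have := LinearMap.pi_apply_eq_sum_univ (g : (Fin n → ℂ) →ₗ[ℂ] ℂ) (fun i => σ (x i))
    simp only [ContinuousLinearMap.coe_coe] at this
    rw [this]
    simp only [z, map_sum, map_smul, smul_eq_mul]
    refine Finset.sum_congr rfl fun i _ => ?_
    rw [mul_comm]
    congr 2
    ext j
    simp [Pi.single_apply, eq_comm]
  have hω2 : u < (ω (realPart z : B)).re := by
    rw [← state_re hω.1, ← hgz]; exact hg2
  have hρ2 : ∀ φ : B →L[ℂ] B, IsElementaryUCP φ → (ρ (φ (realPart z : B))).re < u := by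
    intro φ hφ
    have := state_re (comp_state hρ hφ).1 z
    rw [ContinuousLinearMap.comp_apply, ContinuousLinearMap.comp_apply] at this
    rw [← this]
    have h2 := hg1 _ (subset_closure ⟨φ, hφ, rfl⟩)
    have h3 := hgz (ρ.comp φ)
    simp only [ContinuousLinearMap.comp_apply] at h3
    rw [h3] at h2
    exact h2
  set a : B := (realPart z : B) with ha
  have hasa : IsSelfAdjoint a := (realPart z).2
  have hu1 : IsSelfAdjoint ((u : ℂ) • (1 : B)) := by
    simp [isSelfAdjoint_iff]
  set y : B := a - (u : ℂ) • (1 : B) with hy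
  have hysa : IsSelfAdjoint y := hasa.sub hu1
  by_cases hyN : y⁺ ∈ N
  · have h1 : y ≤ y⁺ := by
      rw [← sub_nonneg]
      nth_rw 2 [← CFC.posPart_sub_negPart y hysa]
      simpa using CFC.negPart_nonneg y
    have h2 := state_mono hω.1 h1
    rw [hωN _ hyN, hy, map_sub, map_smul, hω.2] at h2
    simp at h2
    linarith
  · obtain ⟨φ, hφ, hp⟩ := key_map huniq hysa hyN
    have h1 := (Complex.nonneg_iff.1 (state_nonneg hρ.1 hp)).1
    have h2 := hρ2 φ hφ
    have h3 : ρ (φ 1) = 1 := (comp_state hρ hφ).2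
    rw [hy, map_sub, map_sub, map_smul, map_smul, h3] at h1
    simp at h1
    linarith

lemma norm_one_le_aux : ‖(1 : B)‖ ≤ 1 := by
  rcases subsingleton_or_nontrivial B with h | h
  · simp [Subsingleton.elim (1 : B) 0]
  · exact CStarRing.norm_one.le

lemma isPositive_of_norm {f : B →L[ℂ] ℂ} (hf : ∀ x, ‖f x‖ ≤ ‖x‖) (h1 : f 1 = 1) :
    IsPositiveFunctional f := by
  suffices h : ∀ a : B, 0 ≤ a → 0 ≤ f a from fun a => h _ (star_mul_self_nonneg a)
  intro a ha
  have hsa := ha.isSelfAdjoint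
  have hn1 : ‖(1 : B)‖ ≤ 1 := norm_one_le_aux
  have him : ∀ t : ℝ, (f a).im ^ 2 + 2 * (f a).im * t ≤ ‖a‖ ^ 2 := by
    intro t
    have h2 := hf (a + (t * Complex.I) • (1 : B))
    have h3 : ‖a + (t * Complex.I : ℂ) • (1 : B)‖ ^ 2 ≤ ‖a‖ ^ 2 + t ^ 2 := by
      rw [sq, ← CStarRing.norm_star_mul_self]
      have : star (a + (t * Complex.I : ℂ) • (1 : B)) * (a + (t * Complex.I : ℂ) • (1 : B))
          = a * a + ((t ^ 2 : ℝ) : ℂ) • (1 : B) := by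
        simp only [star_add, star_smul, hsa.star_eq, star_one, add_mul, mul_add, smul_mul_assoc,
          mul_smul_comm, one_mul, mul_one, smul_add, smul_smul]
        simp only [RCLike.star_def, map_mul, Complex.conj_ofReal, Complex.conj_I]
        have e : (t : ℂ) * Complex.I * (t * -Complex.I) = ((t ^ 2 : ℝ) : ℂ) := by
          push_cast
          linear_combination (-(t : ℂ) ^ 2) * Complex.I_sq
        rw [e, mul_neg, neg_smul]
        abel
      rw [this]
      refine (norm_add_le _ _).trans (add_le_add ?_ ?_)
      · rw [sq]; exact norm_mul_le _ _
      · rw [norm_smul, Complex.norm_real, Real.norm_of_nonneg (sq_nonneg t)]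
        nlinarith [sq_nonneg t]
    have h4 : ‖f (a + (t * Complex.I) • (1 : B))‖ ^ 2 ≤ ‖a‖ ^ 2 + t ^ 2 :=
      (pow_le_pow_left₀ (norm_nonneg _) h2 2).trans h3
    rw [map_add, map_smul, h1, ← Complex.normSq_eq_norm_sq, Complex.normSq_apply] at h4
    simp at h4
    nlinarith [sq_nonneg (f a).re]
  have him0 : (f a).im = 0 := by
    by_contra hne
    have := him (‖a‖ ^ 2 / (f a).im)
    have e : 2 * (f a).im * (‖a‖ ^ 2 / (f a).im) = 2 * ‖a‖ ^ 2 := by field_simp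
    rw [e] at this
    have : 0 < (f a).im ^ 2 := by positivity
    nlinarith [sq_nonneg ‖a‖]
  have hre : 0 ≤ (f a).re := by
    have h5 : a ≤ algebraMap ℝ B ‖a‖ := hsa.le_algebraMap_norm_self
    have h6 : ‖algebraMap ℝ B ‖a‖ - a‖ ≤ ‖algebraMap ℝ B ‖a‖‖ :=
      CStarAlgebra.norm_le_norm_of_nonneg_of_le (sub_nonneg.2 h5) (by simpa using ha)
    have h7 : ‖algebraMap ℝ B ‖a‖‖ ≤ ‖a‖ := by
      rw [norm_algebraMap]
      simpa using mul_le_mul_of_nonneg_left hn1 (norm_nonneg a)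
    have h8 := (hf _).trans (h6.trans h7)
    rw [Algebra.algebraMap_eq_smul_one, ← Complex.coe_smul, map_sub, map_smul, h1] at h8
    have h9 := (Complex.abs_re_le_norm _).trans h8
    simp at h9
    have := (abs_le.1 h9).2
    linarith
  exact Complex.nonneg_iff.2 ⟨hre, him0.symm⟩

lemma exists_state {N : Set B} (hN : IsMaximalIdeal N) :
    ∃ ρ : B →L[ℂ] ℂ, IsState ρ ∧ ∀ x ∈ N, ρ x = 0 := by
  have h1N : (1 : B) ∉ N := fun h => hN.2.1 (algIdeal_univ hN.1.2 h)
  let S : Submodule ℂ B :=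
    { carrier := N
      zero_mem' := hN.1.2.1
      add_mem' := fun {x y} hx hy => hN.1.2.2.1 x hx y hy
      smul_mem' := fun c x hx => hN.1.2.2.2.1 c x hx }
  have hn1 : ‖(1 : B)‖ ≤ 1 := norm_one_le_aux
  obtain ⟨g, hg1, hg2⟩ := exists_dual_vector'' ℂ (S.mkQ (1 : B))
  have hle : ∀ x : B, ‖S.mkQ x‖ ≤ ‖x‖ := fun x => Submodule.Quotient.norm_mk_le S x
  have hone : ‖S.mkQ (1 : B)‖ = 1 := by
    refine le_antisymm ((hle 1).trans hn1) ?_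
    by_contra! hlt
    obtain ⟨m, hm1, hm2⟩ := Submodule.Quotient.norm_mk_lt (S := S) (S.mkQ (1 : B)) (sub_pos.2 hlt)
    have hm3 : 1 - m ∈ N := (Submodule.Quotient.eq S).1 hm1.symm
    have := algIdeal_dist hN.1.2 h1N hm3
    simp at this hm2
    linarith
  let f : B →L[ℂ] ℂ := LinearMap.mkContinuous ((g : (B ⧸ S) →ₗ[ℂ] ℂ).comp S.mkQ) 1 (by
    intro x
    rw [one_mul]
    exact ((g.le_of_opNorm_le hg1 _).trans (by rw [one_mul])).trans (hle x))
  have hfa : ∀ x, f x = g (S.mkQ x) := fun x => rfl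
  have hf1 : f 1 = 1 := by rw [hfa, hg2, hone]; simp
  refine ⟨f, ⟨isPositive_of_norm (fun x => ?_) hf1, hf1⟩, fun x hx => ?_⟩
  · rw [hfa]
    exact ((g.le_of_opNorm_le hg1 _).trans (by rw [one_mul])).trans (hle x)
  · rw [hfa]
    have : S.mkQ x = 0 := (Submodule.Quotient.mk_eq_zero S).2 hx
    rw [this, map_zero]

lemma main_aux (N : Set B) (hN : IsMaximalIdeal N)
    (huniq : ∀ N' : Set B, IsMaximalIdeal N' → N' = N)
    (ω : B →L[ℂ] ℂ) (hω : IsState ω) :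
    IsMaximallyMixed ω ↔ ∀ x ∈ N, ω x = 0 := by
  constructor
  · rintro ⟨-, h⟩ x hx
    obtain ⟨ρ, hρ, hρN⟩ := exists_state hN
    have hcl := h ρ hρ (mem_closure_mix huniq hρ hω hρN)
    rw [← norm_le_zero_iff]
    refine le_of_forall_pos_le_add fun ε hε => ?_
    obtain ⟨_, ⟨φ, ⟨n, a, -, ha⟩, rfl⟩, hd⟩ := hcl ε hε 1 (fun _ => x)
    have h0 : ρ (φ x) = 0 := by
      rw [ha, map_sum]
      refine Finset.sum_eq_zero fun i _ => hρN _ ?_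
      exact (hN.1.2.2.2.2 _ _ (hN.1.2.2.2.2 _ _ hx).1).2
    have := hd 0
    simp [h0] at this
    simpa using this.le
  · intro h
    exact ⟨hω, fun ρ hρ _ => mem_closure_mix huniq hω hρ h⟩

end Helpers

/-- **Example/Proposition.** If a unital C*-algebra `A` has exactly one maximal
closed two-sided ideal `N`, then a state `ω` on `A` is maximally mixed if and
only if `ω` vanishes on `N`. -/
theorem maximallyMixed_iff_annihilates_of_unique_maximalIdeal
    (N : Set A) (hN : IsMaximalIdeal N) (huniq : ∀ N' : Set A, IsMaximalIdeal N' → N' = N)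
    (ω : A →L[ℂ] ℂ) (hω : IsState ω) :
    IsMaximallyMixed ω ↔ ∀ x ∈ N, ω x = 0 := by
  let : CStarAlgebra A := {}
  let : PartialOrder A := CStarAlgebra.spectralOrder A
  have : StarOrderedRing A := CStarAlgebra.spectralOrderedRing A
  exact main_aux N hN huniq ω hω

end
end
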